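/- Let M be a generic convex plane curve. Then the number of cusps of the Centre Symmetry Set CSS(M) is at least 3, and the number of cusps of the Wigner caustic E_{1/2}(M) is at least 3. -/

import Mathlib

open Set Filter

noncomputable section

/-- The Euclidean plane. -/
abbrev E2 := EuclideanSpace ℝ (Fin 2)

/-- Planar cross product (determinant of two vectors). -/
def cross2 (u v : E2) : ℝ := u 0 * v 1 - u 1 * v 0

/-- Two vectors span parallel lines. -/
def VParallel (u v : E2) : Prop := cross2 u v = 0

/-- Signed curvature of a parametrized plane curve. -/
def curvature (f : ℝ → E2) (t : ℝ) : ℝ :=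
  cross2 (deriv f t) (deriv (deriv f) t) / ‖deriv f t‖ ^ 3

/-- A smooth regular parametrized plane curve. -/
structure PlaneCurve where
  γ : ℝ → E2
  smooth : ContDiff ℝ (⊤ : ℕ∞) γ
  regular : ∀ t, deriv γ t ≠ 0

/-- A closed curve: the parametrization is periodic (with period 1). -/
def PlaneCurve.IsClosedCurve (M : PlaneCurve) : Prop := Function.Periodic M.γ 1

/-- A convex curve: regular simple closed curve with nonvanishing signed curvature. -/
def PlaneCurve.IsConvexCurve (M : PlaneCurve) : Prop :=
  Function.Periodic M.γ 1 ∧ Set.InjOn M.γ (Set.Ico (0:ℝ) 1) ∧ ∀ t, curvature M.γ t ≠ 0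

/-- `s`, `t` are parameters of a parallel pair of the curve `M`. -/
def ParallelParams (M : PlaneCurve) (s t : ℝ) : Prop :=
  M.γ s ≠ M.γ t ∧ VParallel (deriv M.γ s) (deriv M.γ t)

/-- `a`, `b` is a parallel pair of points of `M`. -/
def ParallelPair (M : PlaneCurve) (a b : E2) : Prop :=
  ∃ s t : ℝ, M.γ s = a ∧ M.γ t = b ∧ ParallelParams M s t

/-- The affine `λ`-equidistant of the curve `M`. -/
def Eqd (M : PlaneCurve) (lam : ℝ) : Set E2 :=
  {x | ∃ a b : E2, ParallelPair M a b ∧ x = lam • a + (1 - lam) • b}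

/-- `p` is a `C^k`-regular point of the set `E`: near `p`, `E` is a `C^k`
one-dimensional manifold. -/
def IsCkRegularPoint (k : ℕ∞) (E : Set E2) (p : E2) : Prop :=
  p ∈ E ∧ ∃ U ∈ nhds p, ∃ f : ℝ → E2, ∃ I : Set ℝ, IsOpen I ∧
    ContDiffOn ℝ k f I ∧ (∀ t ∈ I, deriv f t ≠ 0) ∧ Set.InjOn f I ∧ E ∩ U = f '' I

/-- `p` is a regular point of `E`: a `C^k`-regular point for some `k ≥ 1`. -/
def IsRegularPoint (E : Set E2) (p : E2) : Prop :=
  ∃ k : ℕ, 1 ≤ k ∧ IsCkRegularPoint k E p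

/-- `p` is a singular point of `E`. -/
def IsSingularPoint (E : Set E2) (p : E2) : Prop :=
  p ∈ E ∧ ∀ k : ℕ, 1 ≤ k → ¬ IsCkRegularPoint k E p

/-- `M` is parametrized in opposite directions at the parameters `s` and `t`. -/
def OppositeDirections (M : PlaneCurve) (s t : ℝ) : Prop :=
  ∃ c : ℝ, c < 0 ∧ deriv M.γ t = c • deriv M.γ s

/-- `p` is an (ordinary) cusp point of the set `E`. -/
def IsCuspPoint (E : Set E2) (p : E2) : Prop :=
  p ∈ E ∧ ∃ f : ℝ → E2, ∃ t₀ : ℝ, ContDiff ℝ (⊤ : ℕ∞) f ∧ f t₀ = p ∧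
    deriv f t₀ = 0 ∧
    cross2 (deriv (deriv f) t₀) (deriv (deriv (deriv f)) t₀) ≠ 0 ∧
    ∃ U ∈ nhds p, ∃ ε > (0:ℝ), Set.InjOn f (Set.Ioo (t₀ - ε) (t₀ + ε)) ∧
      E ∩ U = f '' Set.Ioo (t₀ - ε) (t₀ + ε)

/-- The family of chords joining the parallel pairs `γ s`, `γ (T s)`. -/
def chordFamily (M : PlaneCurve) (T : ℝ → ℝ) : ℝ × ℝ → E2 :=
  fun su => M.γ su.1 + su.2 • (M.γ (T su.1) - M.γ su.1)

/-- The Centre Symmetry Set of `M`: the envelope (set of critical values of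
the chord families) of the lines joining parallel pairs of `M`. -/
def CSS (M : PlaneCurve) : Set E2 :=
  {p | ∃ T : ℝ → ℝ, ContDiff ℝ (⊤ : ℕ∞) T ∧ (∀ s, ParallelParams M s (T s)) ∧
    ∃ su : ℝ × ℝ, chordFamily M T su = p ∧
      ¬ Function.Surjective ⇑(fderiv ℝ (chordFamily M T) su)}

/-- The set `E` has a tangent line at `p` directed by `v` (at a regular point the
tangent direction, at a cusp point the limit of tangent directions). -/
def HasTangentLine (E : Set E2) (p v : E2) : Prop :=
  v ≠ 0 ∧ p ∈ E ∧ ∃ f : ℝ → E2, ∃ t₀ : ℝ, ContDiff ℝ (⊤ : ℕ∞) f ∧ f t₀ = p ∧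
    (∃ U ∈ nhds p, ∃ ε > (0:ℝ), E ∩ U = f '' Set.Ioo (t₀ - ε) (t₀ + ε)) ∧
    ((deriv f t₀ ≠ 0 ∧ VParallel v (deriv f t₀)) ∨
     (deriv f t₀ = 0 ∧ deriv (deriv f) t₀ ≠ 0 ∧ VParallel v (deriv (deriv f) t₀)))

/-- A parallel pair of a subset of the plane. -/
def SetParallelPair (E : Set E2) (a b : E2) : Prop :=
  a ≠ b ∧ ∃ v w : E2, HasTangentLine E a v ∧ HasTangentLine E b w ∧ VParallel v w

/-- The affine `λ`-equidistant of a subset of the plane. -/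
def EqdSet (E : Set E2) (lam : ℝ) : Set E2 :=
  {x | ∃ a b : E2, SetParallelPair E a b ∧ x = lam • a + (1 - lam) • b}

/-- The Centre Symmetry Set of a subset of the plane: the envelope of the lines
joining parallel pairs of `E`. -/
def CSSofSet (E : Set E2) : Set E2 :=
  {p | ∃ a b : ℝ → E2, ContDiff ℝ (⊤ : ℕ∞) a ∧ ContDiff ℝ (⊤ : ℕ∞) b ∧
    (∀ s : ℝ, SetParallelPair E (a s) (b s)) ∧
    ∃ su : ℝ × ℝ, a su.1 + su.2 • (b su.1 - a su.1) = p ∧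
      ¬ Function.Surjective
        ⇑(fderiv ℝ (fun q : ℝ × ℝ => a q.1 + q.2 • (b q.1 - a q.1)) su)}

/-- `p` is an inflexion point of the set `E`: the signed curvature of a local
regular parametrization of `E` vanishes at `p`. -/
def IsInflexionPoint (E : Set E2) (p : E2) : Prop :=
  p ∈ E ∧ ∃ f : ℝ → E2, ∃ t₀ : ℝ, ContDiff ℝ (⊤ : ℕ∞) f ∧ f t₀ = p ∧
    deriv f t₀ ≠ 0 ∧
    (∃ U ∈ nhds p, ∃ ε > (0:ℝ), E ∩ U = f '' Set.Ioo (t₀ - ε) (t₀ + ε)) ∧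
    curvature f t₀ = 0

/-- Rotation by 90 degrees. -/
def normalVec (u : E2) : E2 := (EuclideanSpace.equiv (Fin 2) ℝ).symm ![-(u 1), u 0]

/-- The center of curvature of the curve `f` at the parameter `s`. -/
def centerOfCurvature (f : ℝ → E2) (s : ℝ) : E2 :=
  f s + ((curvature f s)⁻¹ * ‖deriv f s‖⁻¹) • normalVec (deriv f s)

/-- The curves `f` and `g` are curved in the same side at the parallel pair
`f s`, `g t`. -/
def CurvedSameSide (f g : ℝ → E2) (s t : ℝ) : Prop :=
  0 < cross2 (deriv f s) (centerOfCurvature f s - f s) *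
      cross2 (deriv f s) (centerOfCurvature g t - g t)

/-- The curves `f` and `g` are curved in different sides at the parallel pair
`f s`, `g t`. -/
def CurvedDiffSides (f g : ℝ → E2) (s t : ℝ) : Prop :=
  cross2 (deriv f s) (centerOfCurvature f s - f s) *
      cross2 (deriv f s) (centerOfCurvature g t - g t) < 0

/-- An embedded smooth arc with endpoints, parametrized by `[0,1]`. -/
structure Arc where
  f : ℝ → E2
  smooth : ContDiff ℝ (⊤ : ℕ∞) f
  regular : ∀ t ∈ Set.Icc (0:ℝ) 1, deriv f t ≠ 0
  inj : Set.InjOn f (Set.Icc (0:ℝ) 1)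

/-- `u` is a tangent vector of the union `F₀ ∪ F₁` at the point `a`. -/
def TangentVecUnion (F₀ F₁ : Arc) (a u : E2) : Prop :=
  (∃ s ∈ Set.Icc (0:ℝ) 1, F₀.f s = a ∧ u = deriv F₀.f s) ∨
  (∃ s ∈ Set.Icc (0:ℝ) 1, F₁.f s = a ∧ u = deriv F₁.f s)

/-- A parallel pair of the union `F₀ ∪ F₁`. -/
def UnionParallelPair (F₀ F₁ : Arc) (a b : E2) : Prop :=
  a ≠ b ∧ ∃ u v : E2, TangentVecUnion F₀ F₁ a u ∧ TangentVecUnion F₀ F₁ b v ∧ VParallel u v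

/-- The affine `λ`-equidistant of the union `F₀ ∪ F₁`. -/
def EqdArcs (F₀ F₁ : Arc) (lam : ℝ) : Set E2 :=
  {x | ∃ a b : E2, UnionParallelPair F₀ F₁ a b ∧ x = lam • a + (1 - lam) • b}

/-- The rotation number of an arc parametrized by `[0,1]`: the total turning
divided by `2π`. -/
def rotationNumber (f : ℝ → E2) : ℝ :=
  (∫ t in (0:ℝ)..1, curvature f t * ‖deriv f t‖) / (2 * Real.pi)

/-- Derivative of the signed curvature with respect to arc length. -/
def curvatureDeriv (f : ℝ → E2) (s : ℝ) : ℝ :=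
  deriv (fun u => curvature f u) s / ‖deriv f s‖

/-- The unit tangent vector compatible with the orientation. -/
def unitTangent (f : ℝ → E2) (s : ℝ) : E2 := ‖deriv f s‖⁻¹ • deriv f s

lemma cross2_smul_right (c : ℝ) (u v : E2) : cross2 u (c • v) = c * cross2 u v := by
  simp only [cross2, PiLp.smul_apply, smul_eq_mul]; ring

lemma cross2_smul_left (c : ℝ) (u v : E2) : cross2 (c • u) v = c * cross2 u v := by
  simp only [cross2, PiLp.smul_apply, smul_eq_mul]; ring

lemma cross2_sub_right (u v w : E2) : cross2 u (v - w) = cross2 u v - cross2 u w := by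
  simp only [cross2, PiLp.sub_apply]; ring

lemma cross2_self (u : E2) : cross2 u u = 0 := by
  simp only [cross2]; ring

lemma cross2_swap (u v : E2) : cross2 u v = -cross2 v u := by
  simp only [cross2]; ring

/-- Parallelism is transitive through a nonzero vector. -/
lemma cross2_eq_zero_trans {u v w : E2} (hv : v ≠ 0) (h₁ : cross2 u v = 0)
    (h₂ : cross2 v w = 0) : cross2 u w = 0 := by
  simp only [cross2] at *
  by_cases h0 : v 0 = 0
  · have h1 : v 1 ≠ 0 := by
      intro h1
      apply hv
      ext i
      fin_cases i <;> simpa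
    apply mul_left_cancel₀ h1
    linear_combination w 1 * h₁ + u 1 * h₂
  · apply mul_left_cancel₀ h0
    linear_combination w 0 * h₁ + u 0 * h₂

/-- The cross product with a fixed left factor, as a continuous linear functional. -/
def crossCLM (u : E2) : E2 →L[ℝ] ℝ :=
  u 0 • EuclideanSpace.proj 1 - u 1 • EuclideanSpace.proj 0

lemma crossCLM_apply (u v : E2) : crossCLM u v = cross2 u v := by
  simp [crossCLM, cross2]

lemma HasDerivAt.cross2_const {f : ℝ → E2} {f' : E2} {x : ℝ} (hf : HasDerivAt f f' x) (u : E2) :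
    HasDerivAt (fun t => cross2 u (f t)) (cross2 u f') x := by
  simpa [Function.comp_def, crossCLM_apply] using (crossCLM u).hasFDerivAt.comp_hasDerivAt x hf

lemma continuous_cross2_const (u : E2) : Continuous (cross2 u) := by
  simpa [funext (crossCLM_apply u)] using (crossCLM u).continuous

/-- If a curve `g`, with limit tangent direction `v` at `t₀`, stays on the trace of `f`, then `f`
passes through `g t₀` with moving direction `d` parallel to `v`. -/
theorem exists_parallel_direction {f d g : ℝ → E2} {ρ c : ℝ → ℝ} {K : Set ℝ} {t₀ : ℝ} {v : E2}
    (hK : IsCompact K) (hf : ∀ x, HasDerivAt f (ρ x • d x) x) (hd : Continuous d)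
    (hv : v ≠ 0) (hgd : ∀ᶠ t in nhds t₀, DifferentiableAt ℝ g t)
    (hgf : ∀ᶠ t in nhds t₀, g t ∈ f '' K)
    (hc : ∀ᶠ t in nhdsWithin t₀ (Ioi t₀), 0 < c t)
    (hlim : Tendsto (fun t => c t • deriv g t) (nhdsWithin t₀ (Ioi t₀)) (nhds v)) :
    ∃ y ∈ K, f y = g t₀ ∧ cross2 v (d y) = 0 := by
  by_contra! hcon
  have hfc : Continuous f := continuous_iff_continuousAt.2 fun x => (hf x).continuousAt
  obtain ⟨ε, hε, hsep⟩ : ∃ ε > (0 : ℝ), ∀ y ∈ K, dist (f y) (g t₀) < ε →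
      ε * |inner ℝ v (d y)| < |cross2 v (d y)| := by
    by_contra! hno
    choose y hyK hy₁ hy₂ using fun n : ℕ => hno (1 / ((n : ℝ) + 1)) (by positivity)
    obtain ⟨a, haK, φ, hφ, hlimy⟩ := hK.tendsto_subseq hyK
    have hsmall : Tendsto (fun n => 1 / ((φ n : ℝ) + 1)) atTop (nhds 0) :=
      tendsto_one_div_add_atTop_nhds_zero_nat.comp hφ.tendsto_atTop
    have hfa : f a = g t₀ := by
      have h₁ : Tendsto (fun n => dist (f (y (φ n))) (g t₀)) atTop (nhds (dist (f a) (g t₀))) :=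
        ((hfc.tendsto a).comp hlimy).dist tendsto_const_nhds
      have h₂ : dist (f a) (g t₀) ≤ 0 :=
        le_of_tendsto_of_tendsto' h₁ hsmall fun n => (hy₁ (φ n)).le
      exact dist_le_zero.1 h₂
    apply hcon a haK hfa
    have hda : Tendsto (fun n => d (y (φ n))) atTop (nhds (d a)) := (hd.tendsto a).comp hlimy
    have h₁ : Tendsto (fun n => |cross2 v (d (y (φ n)))|) atTop (nhds |cross2 v (d a)|) :=
      (((continuous_cross2_const v).tendsto _).comp hda).abs
    have h₂ : Tendsto (fun n => 1 / ((φ n : ℝ) + 1) * |inner ℝ v (d (y (φ n)))|) atTop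
        (nhds (0 * |inner ℝ v (d a)|)) :=
      hsmall.mul (tendsto_const_nhds.inner hda).abs
    rw [zero_mul] at h₂
    exact abs_nonpos_iff.1 (le_of_tendsto_of_tendsto' h₁ h₂ fun n => hy₂ (φ n))
  have hL : ∀ᶠ t in nhdsWithin t₀ (Ioi t₀), 0 < inner ℝ v (deriv g t) := by
    have h : Tendsto (fun t => inner ℝ v (c t • deriv g t)) (nhdsWithin t₀ (Ioi t₀))
        (nhds (inner ℝ v v)) := tendsto_const_nhds.inner hlim
    filter_upwards [h.eventually (lt_mem_nhds (real_inner_self_pos.2 hv)), hc] with t h₁ h₂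
    rw [real_inner_smul_right] at h₁
    exact pos_of_mul_pos_right h₁ h₂.le
  have hN : ∀ᶠ t in nhdsWithin t₀ (Ioi t₀),
      |cross2 v (deriv g t)| ≤ ε * inner ℝ v (deriv g t) := by
    have h : Tendsto (fun t => ε * inner ℝ v (c t • deriv g t) - |cross2 v (c t • deriv g t)|)
        (nhdsWithin t₀ (Ioi t₀)) (nhds (ε * inner ℝ v v - |cross2 v v|)) :=
      ((tendsto_const_nhds.inner hlim).const_mul ε).sub
        (((continuous_cross2_const v).tendsto _).comp hlim).abs
    rw [cross2_self, abs_zero, sub_zero] at h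
    filter_upwards [h.eventually (lt_mem_nhds (mul_pos hε (real_inner_self_pos.2 hv))), hc] with t h₁ h₂
    rw [real_inner_smul_right, cross2_smul_right, abs_mul, abs_of_pos h₂] at h₁
    have h₃ : 0 < c t * (ε * inner ℝ v (deriv g t) - |cross2 v (deriv g t)|) := by linarith
    have := pos_of_mul_pos_right h₃ h₂.le
    linarith
  have hnear : ∀ᶠ t in nhds t₀, dist (g t) (g t₀) < ε :=
    hgd.self_of_nhds.continuousAt.eventually (Metric.ball_mem_nhds _ hε)
  obtain ⟨t₁, ht₁, hall⟩ : ∃ t₁ > t₀, ∀ t ∈ Icc t₀ t₁, DifferentiableAt ℝ g t ∧ g t ∈ f '' K ∧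
      dist (g t) (g t₀) < ε ∧ (t ≠ t₀ → 0 < inner ℝ v (deriv g t) ∧
        |cross2 v (deriv g t)| ≤ ε * inner ℝ v (deriv g t)) := by
    have hev : ∀ᶠ t in nhdsWithin t₀ (Ici t₀), DifferentiableAt ℝ g t ∧ g t ∈ f '' K ∧
      dist (g t) (g t₀) < ε ∧ (t ≠ t₀ → 0 < inner ℝ v (deriv g t) ∧
        |cross2 v (deriv g t)| ≤ ε * inner ℝ v (deriv g t)) := by
      have hLN := eventually_nhdsWithin_iff.1 (hL.and hN)
      filter_upwards [nhdsWithin_le_nhds hgd, nhdsWithin_le_nhds hgf, nhdsWithin_le_nhds hnear,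
        nhdsWithin_le_nhds hLN, self_mem_nhdsWithin] with t h₁ h₂ h₃ h₄ h₅
      exact ⟨h₁, h₂, h₃, fun hne => h₄ (lt_of_le_of_ne h₅ hne.symm)⟩
    obtain ⟨t₁, h₁, h₂⟩ := mem_nhdsGE_iff_exists_Icc_subset.1 hev
    exact ⟨t₁, h₁, fun t ht => h₂ ht⟩
  have hLd : ∀ t ∈ Icc t₀ t₁, HasDerivAt (fun t => inner ℝ v (g t)) (inner ℝ v (deriv g t)) t := by
    intro t ht
    simpa using (hasDerivAt_const t v).inner ℝ (hall t ht).1.hasDerivAt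
  have hNd : ∀ t ∈ Icc t₀ t₁, HasDerivAt (fun t => cross2 v (g t)) (cross2 v (deriv g t)) t :=
    fun t ht => (hall t ht).1.hasDerivAt.cross2_const v
  have hmono : ∀ s : ℝ, |s| = 1 →
      MonotoneOn (fun t => ε * inner ℝ v (g t) + s * cross2 v (g t)) (Icc t₀ t₁) := by
    intro s hs
    have hder : ∀ t ∈ Icc t₀ t₁, HasDerivAt (fun t => ε * inner ℝ v (g t) + s * cross2 v (g t))
        (ε * inner ℝ v (deriv g t) + s * cross2 v (deriv g t)) t :=
      fun t ht => ((hLd t ht).const_mul ε).add ((hNd t ht).const_mul s)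
    apply monotoneOn_of_deriv_nonneg (convex_Icc _ _)
      (fun t ht => (hder t ht).continuousAt.continuousWithinAt)
      (fun t ht => (hder t (interior_subset ht)).differentiableAt.differentiableWithinAt)
    intro t ht
    rw [interior_Icc] at ht
    rw [(hder t (Ioo_subset_Icc_self ht)).deriv]
    have h₁ := ((hall t (Ioo_subset_Icc_self ht)).2.2.2 ht.1.ne').2
    have h₂ : |s * cross2 v (deriv g t)| = |cross2 v (deriv g t)| := by rw [abs_mul, hs, one_mul]
    have := neg_abs_le (s * cross2 v (deriv g t))
    linarith
  have hLmono : StrictMonoOn (fun t => inner ℝ v (g t)) (Icc t₀ t₁) := by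
    apply strictMonoOn_of_deriv_pos (convex_Icc _ _)
      (fun t ht => (hLd t ht).continuousAt.continuousWithinAt)
    intro t ht
    rw [interior_Icc] at ht
    rw [(hLd t (Ioo_subset_Icc_self ht)).deriv]
    exact ((hall t (Ioo_subset_Icc_self ht)).2.2.2 ht.1.ne').1
  have hcone' : ∀ t ∈ Icc t₀ t₁, ∀ t' ∈ Icc t₀ t₁, t ≤ t' →
      |cross2 v (g t') - cross2 v (g t)| ≤ ε * |inner ℝ v (g t') - inner ℝ v (g t)| := by
    intro t ht t' ht' htt'
    have h₁ := hmono 1 (by simp) ht ht' htt'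
    have h₂ := hmono (-1) (by simp) ht ht' htt'
    have h₃ := hLmono.monotoneOn ht ht' htt'
    simp only at h₁ h₂ h₃
    rw [abs_of_nonneg (sub_nonneg.2 h₃), abs_le]
    constructor <;> linarith
  have hcone : ∀ t ∈ Icc t₀ t₁, ∀ t' ∈ Icc t₀ t₁,
      |cross2 v (g t') - cross2 v (g t)| ≤ ε * |inner ℝ v (g t') - inner ℝ v (g t)| := by
    intro t ht t' ht'
    rcases le_total t t' with h | h
    · exact hcone' t ht t' ht' h
    · rw [abs_sub_comm, abs_sub_comm (inner ℝ v (g t'))]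
      exact hcone' t' ht' t ht h
  set Y : Set ℝ := {y | y ∈ K ∧ ∃ t ∈ Icc t₀ t₁, f y = g t} with hY
  have hcrit : ∀ y ∈ Y, HasFDerivWithinAt (fun y => inner ℝ v (f y)) (0 : ℝ →L[ℝ] ℝ) Y y := by
    intro y hy
    by_cases hacc : AccPt y (Filter.principal Y)
    swap
    · exact HasFDerivWithinAt.of_not_accPt hacc
    have hne : (nhdsWithin y (Y \ {y})).NeBot := accPt_principal_iff_nhdsWithin.1 hacc
    obtain ⟨hyK, t, ht, hyt⟩ := hy
    have hdL : HasDerivAt (fun y => inner ℝ v (f y)) (ρ y * inner ℝ v (d y)) y := by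
      simpa [real_inner_smul_right] using (hasDerivAt_const y v).inner ℝ (hf y)
    have hdN : HasDerivAt (fun y => cross2 v (f y)) (ρ y * cross2 v (d y)) y := by
      simpa [cross2_smul_right] using (hf y).cross2_const v
    have hle : nhdsWithin y (Y \ {y}) ≤ nhdsWithin y {y}ᶜ :=
      nhdsWithin_mono _ fun z hz => hz.2
    have hsL := ((hasDerivAt_iff_tendsto_slope.1 hdL).mono_left hle).abs.const_mul ε
    have hsN := ((hasDerivAt_iff_tendsto_slope.1 hdN).mono_left hle).abs
    have hcomp : |ρ y * cross2 v (d y)| ≤ ε * |ρ y * inner ℝ v (d y)| := by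
      apply le_of_tendsto_of_tendsto hsN hsL
      filter_upwards [self_mem_nhdsWithin] with z hz
      obtain ⟨⟨-, t', ht', hzt⟩, -⟩ := hz
      rw [slope_def_field, slope_def_field, abs_div, abs_div, ← mul_div_assoc]
      gcongr
      simp only [hyt, hzt]
      exact hcone t ht t' ht'
    have hρ : ρ y = 0 := by
      by_contra hρ
      have h₁ := hsep y hyK (by rw [hyt]; exact (hall t ht).2.2.1)
      rw [abs_mul, abs_mul] at hcomp
      have h₂ : 0 < |ρ y| := abs_pos.2 hρ
      nlinarith
    rw [hρ, zero_mul] at hdL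
    have h := hdL.hasFDerivAt.hasFDerivWithinAt (s := Y)
    have hz : ContinuousLinearMap.toSpanSingleton ℝ (0 : ℝ) = 0 := by ext; simp
    rwa [hz] at h
  have hnull : MeasureTheory.volume ((fun y => inner ℝ v (f y)) '' Y) = 0 := by
    apply MeasureTheory.addHaar_image_eq_zero_of_det_fderivWithin_eq_zero _ hcrit
    intro y _
    simp [ContinuousLinearMap.det]
  have hsub : Icc (inner ℝ v (g t₀)) (inner ℝ v (g t₁)) ⊆ (fun y => inner ℝ v (f y)) '' Y := by
    intro z hz
    obtain ⟨t, ht, rfl⟩ := intermediate_value_Icc ht₁.le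
      (fun t ht => (hLd t ht).continuousAt.continuousWithinAt) hz
    obtain ⟨y, hyK, hy⟩ := (hall t ht).2.1
    exact ⟨y, ⟨hyK, t, ht, hy⟩, by simp only [hy]⟩
  have hpos := MeasureTheory.measure_mono_null hsub hnull
  rw [Real.volume_Icc, ENNReal.ofReal_eq_zero] at hpos
  have := hLmono (left_mem_Icc.2 ht₁.le) (right_mem_Icc.2 ht₁.le) ht₁
  simp only at this
  linarith

/-- A mean value theorem centred at `a`, for both sides at once. -/
lemma exists_slope_eq_deriv {q q' : ℝ → ℝ} (hq : ∀ t, HasDerivAt q (q' t) t) {a t : ℝ}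
    (ht : t ≠ a) :
    ∃ ξ, |ξ - a| < |t - a| ∧ 0 < (ξ - a) * (t - a) ∧ q t - q a = q' ξ * (t - a) := by
  have hcont : Continuous q := continuous_iff_continuousAt.2 fun x => (hq x).continuousAt
  rcases lt_or_gt_of_ne ht with h | h
  · obtain ⟨ξ, hξ, hs⟩ := exists_hasDerivAt_eq_slope q q' h hcont.continuousOn fun x _ => hq x
    refine ⟨ξ, ?_, mul_pos_of_neg_of_neg (by linarith [hξ.2]) (by linarith), ?_⟩
    · rw [abs_of_neg (by linarith [hξ.2]), abs_of_neg (by linarith)]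
      linarith [hξ.1]
    · rw [hs]
      have := sub_ne_zero.2 h.ne'
      field_simp
      ring
  · obtain ⟨ξ, hξ, hs⟩ := exists_hasDerivAt_eq_slope q q' h hcont.continuousOn fun x _ => hq x
    refine ⟨ξ, ?_, mul_pos (by linarith [hξ.1]) (by linarith), ?_⟩
    · rw [abs_of_pos (by linarith [hξ.1]), abs_of_pos (by linarith)]
      linarith [hξ.2]
    · rw [hs]
      have := sub_ne_zero.2 h.ne'
      field_simp

/-- A function whose first nonvanishing derivative at `a` is the third takes values above `q a`
arbitrarily close to `a`. -/
lemma frequently_lt_of_third_deriv_ne_zero {q q₁ q₂ : ℝ → ℝ} {q₃ a : ℝ}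
    (h₁ : ∀ t, HasDerivAt q (q₁ t) t) (h₂ : ∀ t, HasDerivAt q₁ (q₂ t) t)
    (h₃ : HasDerivAt q₂ q₃ a) (z₁ : q₁ a = 0) (z₂ : q₂ a = 0) (z₃ : q₃ ≠ 0) :
    ∃ᶠ t in nhds a, q a < q t := by
  have hslope := (hasDerivAt_iff_tendsto_slope.1 h₃).mul_const q₃
  have hev := hslope.eventually (lt_mem_nhds (mul_self_pos.2 z₃))
  rw [eventually_nhdsWithin_iff] at hev
  obtain ⟨δ, hδ, hball⟩ := Metric.eventually_nhds_iff.1 hev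
  rw [Metric.nhds_basis_ball.frequently_iff]
  intro η hη
  set r : ℝ := min δ η / 2 with hr
  have hm : 0 < min δ η := lt_min hδ hη
  have hr0 : 0 < r := by positivity
  have hrδ : r < δ := by linarith [min_le_left δ η]
  have hrη : r < η := by linarith [min_le_right δ η]
  obtain ⟨s, hs, hsq⟩ : ∃ s : ℝ, |s| = r ∧ 0 < q₃ * s := by
    rcases lt_or_gt_of_ne z₃ with h | h
    · exact ⟨-r, by rw [abs_neg, abs_of_pos hr0], by nlinarith⟩
    · exact ⟨r, abs_of_pos hr0, by positivity⟩
  have hs0 : s ≠ 0 := fun h => by simp [h] at hsq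
  obtain ⟨ξ, hξ, hξs, hq⟩ := exists_slope_eq_deriv h₁ (a := a) (t := a + s) (by simpa)
  have hξa : ξ ≠ a := fun h => by simp [h] at hξs
  obtain ⟨ζ, hζ, hζs, hq'⟩ := exists_slope_eq_deriv h₂ hξa
  have hζa : ζ ≠ a := fun h => by simp [h] at hζs
  simp only [add_sub_cancel_left] at hξ hξs hq
  refine ⟨a + s, by simp [hs, hrη], ?_⟩
  have hsl := hball (y := ζ) (by rw [Real.dist_eq]; linarith) hζa
  rw [slope_def_field, z₂, sub_zero, div_mul_eq_mul_div] at hsl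
  rw [z₁, sub_zero] at hq'
  rw [hq'] at hq
  have hζ' : ζ - a ≠ 0 := sub_ne_zero.2 hζa
  have e₁ : 0 < q₂ ζ * q₃ * (ζ - a) := by
    have := mul_pos hsl (mul_self_pos.2 hζ')
    have e : q₂ ζ * q₃ / (ζ - a) * ((ζ - a) * (ζ - a)) = q₂ ζ * q₃ * (ζ - a) := by field_simp
    rwa [e] at this
  have e₂ : 0 < (q₂ ζ * q₃ * (ζ - a)) * ((ζ - a) * (ξ - a)) * ((ξ - a) * s) * (q₃ * s) := by
    positivity
  have e₃ : (q₂ ζ * q₃ * (ζ - a)) * ((ζ - a) * (ξ - a)) * ((ξ - a) * s) * (q₃ * s) =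
      (q₂ ζ * (ξ - a) * s) * (q₃ * (ζ - a)* (ξ - a) * s) * (q₃ * (ζ - a)* (ξ - a) * s)
        / ((ξ - a) * s) := by
    have : ξ - a ≠ 0 := sub_ne_zero.2 hξa
    field_simp
  have e₄ : 0 < q₂ ζ * (ξ - a) * s := by
    by_contra! hneg
    have : (q₂ ζ * (ξ - a) * s) * (q₃ * (ζ - a)* (ξ - a) * s) * (q₃ * (ζ - a)* (ξ - a) * s)
        / ((ξ - a) * s) ≤ 0 := by
      apply div_nonpos_of_nonpos_of_nonneg _ hξs.le
      rw [mul_assoc]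
      exact mul_nonpos_of_nonpos_of_nonneg hneg (mul_self_nonneg _)
    linarith
  linarith

lemma not_isLocalExtr_of_third_deriv_ne_zero {q q₁ q₂ : ℝ → ℝ} {q₃ a : ℝ}
    (h₁ : ∀ t, HasDerivAt q (q₁ t) t) (h₂ : ∀ t, HasDerivAt q₁ (q₂ t) t)
    (h₃ : HasDerivAt q₂ q₃ a) (z₁ : q₁ a = 0) (z₂ : q₂ a = 0) (z₃ : q₃ ≠ 0) :
    ¬ IsLocalExtr q a := by
  rintro (h | h)
  · have := frequently_lt_of_third_deriv_ne_zero (q := fun t => -q t) (q₁ := fun t => -q₁ t)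
      (q₂ := fun t => -q₂ t) (fun t => (h₁ t).neg) (fun t => (h₂ t).neg) h₃.neg (by simp [z₁])
      (by simp [z₂]) (neg_ne_zero.2 z₃)
    refine this (Filter.Eventually.mono h fun t ht => ?_)
    simpa using ht
  · exact frequently_lt_of_third_deriv_ne_zero h₁ h₂ h₃ z₁ z₂ z₃
      (Filter.Eventually.mono h fun t ht => not_lt.2 ht)

/-- A closed curve `f` moving along a direction field `d` which makes, over the period `π` of `f`,
exactly one half-turn without ever turning back. -/
structure IsHalfTurnCurve (f d : ℝ → E2) (ρ : ℝ → ℝ) : Prop where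
  hasDerivAt : ∀ x, HasDerivAt f (ρ x • d x) x
  continuous_dir : Continuous d
  periodic : Function.Periodic f Real.pi
  parallel : ∀ x y, cross2 (d x) (d y) = 0 → ∃ k : ℤ, y = x + k * Real.pi

namespace IsHalfTurnCurve

variable {f d : ℝ → E2} {ρ : ℝ → ℝ}

lemma continuous (h : IsHalfTurnCurve f d ρ) : Continuous f :=
  continuous_iff_continuousAt.2 fun x => (h.hasDerivAt x).continuousAt

lemma dir_ne_zero (h : IsHalfTurnCurve f d ρ) (x : ℝ) : d x ≠ 0 := by
  intro h0
  obtain ⟨k, hk⟩ := h.parallel x (x + Real.pi / 2) (by simp [cross2, h0])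
  have h₁ : (k : ℝ) * 2 = 1 := by
    apply mul_right_cancel₀ Real.pi_ne_zero
    linarith
  have h₂ : k * 2 = 1 := by exact_mod_cast h₁
  omega

lemma eq_of_parallel (h : IsHalfTurnCurve f d ρ) {x y : ℝ} (hxy : cross2 (d x) (d y) = 0) :
    f x = f y := by
  obtain ⟨k, rfl⟩ := h.parallel x y hxy
  exact (h.periodic.int_mul k x).symm

lemma range_eq (h : IsHalfTurnCurve f d ρ) : range f = f '' Icc 0 Real.pi := by
  have := h.periodic.image_Icc Real.pi_pos 0
  rw [zero_add] at this
  exact this.symm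

lemma isCompact_range (h : IsHalfTurnCurve f d ρ) : IsCompact (range f) := by
  rw [h.range_eq]
  exact isCompact_Icc.image h.continuous

/-- Extreme points of the trace in the direction normal to `d x` are singular, except possibly
`f x` itself. -/
lemma isSingularPoint_of_isExtrOn (h : IsHalfTurnCurve f d ρ) {x : ℝ} {p : E2}
    (hp : p ∈ range f) (hpx : p ≠ f x) (hext : IsExtrOn (cross2 (d x)) (range f) p) :
    IsSingularPoint (range f) p := by
  refine ⟨hp, ?_⟩
  rintro k hk ⟨-, U, hU, g, I, hI, hg, hg0, -, hEU⟩
  obtain ⟨t₀, ht₀, rfl⟩ : p ∈ g '' I := hEU ▸ ⟨hp, mem_of_mem_nhds hU⟩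
  have hsub : ∀ t ∈ I, g t ∈ range f := fun t ht =>
    (hEU.symm.subset (mem_image_of_mem g ht)).1
  have hIn : ∀ᶠ t in nhds t₀, t ∈ I := hI.mem_nhds ht₀
  have hk' : ((k : ℕ∞) : WithTop ℕ∞) ≠ 0 := by
    simpa using (by omega : k ≠ 0)
  have hdiff : ∀ t ∈ I, DifferentiableAt ℝ g t := fun t ht =>
    (hg.contDiffAt (hI.mem_nhds ht)).differentiableAt hk'
  have hcd : ContinuousAt (deriv g) t₀ := by
    have h1 : ContDiffOn ℝ 1 g I := hg.of_le (by exact_mod_cast hk)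
    exact (h1.continuousOn_deriv_of_isOpen hI le_rfl).continuousAt (hI.mem_nhds ht₀)
  obtain ⟨y, -, hy, hpar⟩ := exists_parallel_direction (c := fun _ => 1) isCompact_Icc h.hasDerivAt
    h.continuous_dir (hg0 t₀ ht₀) (hIn.mono hdiff)
    (hIn.mono fun t ht => by rw [← h.range_eq]; exact hsub t ht)
    (Eventually.of_forall fun _ => one_pos)
    (by simpa using hcd.tendsto.mono_left nhdsWithin_le_nhds)
  have hloc : IsLocalExtr (fun t => cross2 (d x) (g t)) t₀ := by
    rcases hext with hm | hm
    · exact Or.inl (hIn.mono fun t ht => hm (hsub t ht))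
    · exact Or.inr (hIn.mono fun t ht => hm (hsub t ht))
  have hzero := hloc.hasDerivAt_eq_zero ((hdiff t₀ ht₀).hasDerivAt.cross2_const (d x))
  exact hpx (hy ▸ (h.eq_of_parallel (cross2_eq_zero_trans (hg0 t₀ ht₀) hzero hpar)).symm)

/-- Through a cusp point the curve moves in the direction of the cusp, and the cusp point is not
extreme in the direction normal to the cusp. -/
lemma exists_not_isExtrOn_of_isCuspPoint (h : IsHalfTurnCurve f d ρ) {p : E2}
    (hp : IsCuspPoint (range f) p) :
    ∃ y, f y = p ∧ ¬ IsExtrOn (cross2 (d y)) (range f) p := by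
  obtain ⟨-, g, t₀, hg, rfl, hg0, hcross, U, hU, ε, hε, -, hEU⟩ := hp
  have hsub : ∀ᶠ t in nhds t₀, g t ∈ range f := by
    filter_upwards [Ioo_mem_nhds (show t₀ - ε < t₀ by linarith) (show t₀ < t₀ + ε by linarith)]
      with t ht
    exact (hEU.symm.subset (mem_image_of_mem g ht)).1
  obtain ⟨hd₁, hg₁⟩ := contDiff_infty_iff_deriv.1 hg
  obtain ⟨hd₂, hg₂⟩ := contDiff_infty_iff_deriv.1 hg₁
  obtain ⟨hd₃, -⟩ := contDiff_infty_iff_deriv.1 hg₂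
  have hv : deriv (deriv g) t₀ ≠ 0 := fun h0 => hcross (by simp [h0, cross2])
  have hlim : Tendsto (fun t => (t - t₀)⁻¹ • deriv g t) (nhdsWithin t₀ (Ioi t₀))
      (nhds (deriv (deriv g) t₀)) := by
    have hs := (hasDerivAt_iff_tendsto_slope.1 (hd₂ t₀).hasDerivAt).mono_left
      (nhdsWithin_mono t₀ (fun t (ht : t₀ < t) => ht.ne'))
    refine hs.congr fun t => ?_
    simp [slope, hg0]
  obtain ⟨y, -, hy, hpar⟩ := exists_parallel_direction (c := fun t => (t - t₀)⁻¹) isCompact_Icc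
    h.hasDerivAt h.continuous_dir hv (Eventually.of_forall fun t => hd₁ t)
    (hsub.mono fun t ht => by rw [← h.range_eq]; exact ht)
    (by filter_upwards [self_mem_nhdsWithin] with t ht using inv_pos.2 (sub_pos.2 ht)) hlim
  refine ⟨y, hy, fun hext => ?_⟩
  have hpar' : cross2 (d y) (deriv (deriv g) t₀) = 0 := by rw [cross2_swap, hpar, neg_zero]
  apply not_isLocalExtr_of_third_deriv_ne_zero (q := fun t => cross2 (d y) (g t))
    (fun t => (hd₁ t).hasDerivAt.cross2_const (d y))
    (fun t => (hd₂ t).hasDerivAt.cross2_const (d y))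
    ((hd₃ t₀).hasDerivAt.cross2_const (d y)) (by simp [hg0, cross2]) hpar'
  · intro h0
    exact hcross (cross2_eq_zero_trans (h.dir_ne_zero y) hpar h0)
  · rcases hext with hm | hm
    · exact Or.inl (hsub.mono fun t ht => hm ht)
    · exact Or.inr (hsub.mono fun t ht => hm ht)

lemma not_isCkRegularPoint_of_singleton {p : E2} {k : ℕ∞} : ¬ IsCkRegularPoint k {p} p := by
  rintro ⟨-, U, hU, g, I, hI, -, -, hinj, hEU⟩
  obtain ⟨t, ht, -⟩ : p ∈ g '' I := hEU ▸ ⟨rfl, mem_of_mem_nhds hU⟩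
  have hval : ∀ s ∈ I, g s = p := fun s hs => (hEU.symm.subset (mem_image_of_mem g hs)).1
  have hs : I.Subsingleton := fun a ha b hb => hinj ha hb (by rw [hval a ha, hval b hb])
  have : I = {t} := hs.eq_singleton_of_mem ht
  exact not_isOpen_singleton t (this ▸ hI)

lemma not_isCuspPoint_singleton {p : E2} : ¬ IsCuspPoint {p} p := by
  rintro ⟨-, g, t₀, -, -, -, -, U, -, ε, hε, hinj, hEU⟩
  have hval : ∀ s ∈ Ioo (t₀ - ε) (t₀ + ε), g s = p := fun s hs =>
    (hEU.symm.subset (mem_image_of_mem g hs)).1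
  have h₁ : t₀ ∈ Ioo (t₀ - ε) (t₀ + ε) := ⟨by linarith, by linarith⟩
  have h₂ : t₀ + ε / 2 ∈ Ioo (t₀ - ε) (t₀ + ε) := ⟨by linarith, by linarith⟩
  have := hinj h₁ h₂ (by rw [hval _ h₁, hval _ h₂])
  linarith

/-- If the trace lies on a line parallel to some `d x`, it is a single point. -/
lemma eq_of_cross2_const (h : IsHalfTurnCurve f d ρ) {x : ℝ}
    (hconst : ∀ y, cross2 (d x) (f y) = cross2 (d x) (f x)) (y : ℝ) : f y = f x := by
  have hρ : ∀ z ∈ Ioo x (x + Real.pi), ρ z = 0 := by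
    intro z hz
    have h₁ : HasDerivAt (fun y => cross2 (d x) (f y)) 0 z := by
      simp only [hconst]; exact hasDerivAt_const z _
    have h₂ := h₁.unique ((h.hasDerivAt z).cross2_const (d x))
    rw [cross2_smul_right] at h₂
    rcases mul_eq_zero.1 h₂.symm with h₃ | h₃
    · exact h₃
    obtain ⟨k, rfl⟩ := h.parallel x z h₃
    exfalso
    have h₄ : (0 : ℝ) < k := by
      by_contra! hk
      nlinarith [hz.1, Real.pi_pos]
    have h₅ : (k : ℝ) < 1 := by
      by_contra! hk
      nlinarith [hz.2, Real.pi_pos]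
    have h₆ : 0 < k := by exact_mod_cast h₄
    have h₇ : k < 1 := by exact_mod_cast h₅
    omega
  obtain ⟨z, hz, hzy⟩ := h.periodic.exists_mem_Ico Real.pi_pos y x
  rw [hzy]
  rcases eq_or_lt_of_le hz.1 with rfl | hlt
  · rfl
  have hE : ∀ i, f z i = f x i := by
    intro i
    have hd : ∀ w, HasDerivAt (fun t => f t i) (ρ w * d w i) w := fun w => by
      simpa [Function.comp_def] using (EuclideanSpace.proj (𝕜 := ℝ) i).hasFDerivAt.comp_hasDerivAt w
        (h.hasDerivAt w)
    obtain ⟨w, hw, he⟩ := exists_hasDerivAt_eq_slope _ _ hlt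
      (fun w _ => (hd w).continuousAt.continuousWithinAt) (fun w _ => hd w)
    rw [hρ w ⟨hw.1, hw.2.trans hz.2⟩, zero_mul] at he
    have := sub_ne_zero.2 hlt.ne'
    rw [eq_comm, div_eq_zero_iff] at he
    rcases he with he | he
    · linarith
    · exact absurd he this
  ext i
  exact hE i

/-- A half-turn curve all of whose singular points are ordinary cusps has at least three cusps. -/
theorem three_le_ncard_cusps (h : IsHalfTurnCurve f d ρ)
    (hgen : ∀ p, IsSingularPoint (range f) p → IsCuspPoint (range f) p)
    (hfin : {p | IsCuspPoint (range f) p}.Finite) :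
    3 ≤ {p | IsCuspPoint (range f) p}.ncard := by
  have hex : ∀ x, ∃ a ∈ range f, ∃ b ∈ range f, a ≠ b ∧ IsExtrOn (cross2 (d x)) (range f) a ∧
      IsExtrOn (cross2 (d x)) (range f) b := by
    intro x
    obtain ⟨a, ha, hamax⟩ := h.isCompact_range.exists_isMaxOn (range_nonempty f)
      (continuous_cross2_const (d x)).continuousOn
    obtain ⟨b, hb, hbmin⟩ := h.isCompact_range.exists_isMinOn (range_nonempty f)
      (continuous_cross2_const (d x)).continuousOn
    refine ⟨a, ha, b, hb, ?_, hamax.isExtr, hbmin.isExtr⟩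
    rintro rfl
    have hall : ∀ y, cross2 (d x) (f y) = cross2 (d x) a := fun y =>
      le_antisymm (hamax (mem_range_self y)) (hbmin (mem_range_self y))
    have hcst := h.eq_of_cross2_const (x := x) fun y => by rw [hall, hall]
    have hE : range f = {f x} := by
      ext p
      constructor
      · rintro ⟨y, rfl⟩
        exact hcst y
      · rintro rfl
        exact mem_range_self x
    rw [hE] at hgen
    exact not_isCuspPoint_singleton
      (hgen (f x) ⟨rfl, fun k _ => not_isCkRegularPoint_of_singleton⟩)
  have hcusp : ∀ x, ∀ p ∈ range f, IsExtrOn (cross2 (d x)) (range f) p → p ≠ f x →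
      IsCuspPoint (range f) p := fun x p hp he hne =>
    hgen p (h.isSingularPoint_of_isExtrOn hp hne he)
  obtain ⟨c, hc⟩ : ∃ c, IsCuspPoint (range f) c := by
    obtain ⟨a, ha, b, hb, hab, hea, heb⟩ := hex 0
    by_cases h0 : a = f 0
    · exact ⟨b, hcusp 0 b hb heb fun hb0 => hab (h0.trans hb0.symm)⟩
    · exact ⟨a, hcusp 0 a ha hea h0⟩
  obtain ⟨y, rfl, hy⟩ := h.exists_not_isExtrOn_of_isCuspPoint hc
  obtain ⟨a, ha, b, hb, hab, hea, heb⟩ := hex y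
  have hac : a ≠ f y := fun e => hy (e ▸ hea)
  have hbc : b ≠ f y := fun e => hy (e ▸ heb)
  exact (Set.two_lt_ncard hfin).2
    ⟨a, hcusp y a ha hea hac, b, hcusp y b hb heb hbc, f y, hc, hab, hac, hbc⟩

end IsHalfTurnCurve

/-- The unit vector at angle `x`. -/
def dirVec (x : ℝ) : E2 := !₂[Real.cos x, Real.sin x]

@[simp] lemma dirVec_zero (x : ℝ) : dirVec x 0 = Real.cos x := rfl

@[simp] lemma dirVec_one (x : ℝ) : dirVec x 1 = Real.sin x := rfl

lemma cross2_dirVec (x y : ℝ) : cross2 (dirVec x) (dirVec y) = Real.sin (y - x) := by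
  simp only [cross2, dirVec_zero, dirVec_one, Real.sin_sub]; ring

lemma dirVec_add_pi (x : ℝ) : dirVec (x + Real.pi) = (-1 : ℝ) • dirVec x := by
  ext i
  fin_cases i <;> simp [dirVec]

lemma contDiff_dirVec : ContDiff ℝ (⊤ : ℕ∞) dirVec := by
  rw [contDiff_euclidean]
  intro i
  fin_cases i
  · exact Real.contDiff_cos
  · exact Real.contDiff_sin

lemma HasDerivAt.apply_euclidean {f : ℝ → E2} {f' : E2} {x : ℝ} (hf : HasDerivAt f f' x)
    (i : Fin 2) : HasDerivAt (fun t => f t i) (f' i) x := by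
  simpa [Function.comp_def] using
    (EuclideanSpace.proj (𝕜 := ℝ) i).hasFDerivAt.comp_hasDerivAt x hf

lemma strictMonoOn_of_hasDerivAt_pos {Y Y' : ℝ → ℝ} {a b : ℝ} (hY : ∀ x, HasDerivAt Y (Y' x) x)
    (hpos : ∀ x ∈ Ioo a b, 0 < Y' x) : StrictMonoOn Y (Icc a b) := by
  apply strictMonoOn_of_deriv_pos (convex_Icc _ _)
    (fun t _ => (hY t).continuousAt.continuousWithinAt)
  intro t ht
  rw [interior_Icc] at ht
  rw [(hY t).deriv]
  exact hpos t ht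

lemma strictAntiOn_of_hasDerivAt_neg {Y Y' : ℝ → ℝ} {a b : ℝ} (hY : ∀ x, HasDerivAt Y (Y' x) x)
    (hneg : ∀ x ∈ Ioo a b, Y' x < 0) : StrictAntiOn Y (Icc a b) := by
  apply strictAntiOn_of_deriv_neg (convex_Icc _ _)
    (fun t _ => (hY t).continuousAt.continuousWithinAt)
  intro t ht
  rw [interior_Icc] at ht
  rw [(hY t).deriv]
  exact hneg t ht

/-- A convex arc making a full turn whose endpoints lie on a common tangent line, the final one
not behind the initial one, intersects itself. -/
lemma exists_self_intersection {X Y r : ℝ → ℝ} (hr : ∀ x, 0 < r x)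
    (hX : ∀ x, HasDerivAt X (r x * Real.cos x) x) (hY : ∀ x, HasDerivAt Y (r x * Real.sin x) x)
    (hX0 : X 0 ≤ X (2 * Real.pi)) (hY0 : Y 0 = Y (2 * Real.pi)) :
    ∃ a b, a < b ∧ b ≤ a + 2 * Real.pi ∧ X a = X b ∧ Y a = Y b := by
  have hpi := Real.pi_pos
  have hXc : Continuous X := continuous_iff_continuousAt.2 fun x => (hX x).continuousAt
  have hYc : Continuous Y := continuous_iff_continuousAt.2 fun x => (hY x).continuousAt
  have hup : StrictMonoOn Y (Icc 0 Real.pi) := strictMonoOn_of_hasDerivAt_pos hY fun x hx =>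
    mul_pos (hr x) (Real.sin_pos_of_pos_of_lt_pi hx.1 hx.2)
  have hsneg : ∀ x ∈ Ioo Real.pi (2 * Real.pi), Real.sin x < 0 := by
    intro x hx
    have := Real.sin_pos_of_pos_of_lt_pi (x := x - Real.pi) (by linarith [hx.1])
      (by linarith [hx.2])
    rw [Real.sin_sub_pi] at this
    linarith
  have hdown : StrictAntiOn Y (Icc Real.pi (2 * Real.pi)) :=
    strictAntiOn_of_hasDerivAt_neg hY fun x hx => mul_neg_of_pos_of_neg (hr x) (hsneg x hx)
  have hback : StrictAntiOn X (Icc (Real.pi / 2) (Real.pi + Real.pi / 2)) :=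
    strictAntiOn_of_hasDerivAt_neg hX fun x hx =>
      mul_neg_of_pos_of_neg (hr x) (Real.cos_neg_of_pi_div_two_lt_of_lt hx.1 hx.2)
  obtain ⟨a₁, b₁, ha₁, hb₁, hab₁⟩ : ∃ a₁ b₁, a₁ ∈ Ico (Real.pi / 2) Real.pi ∧
      b₁ ∈ Icc Real.pi (Real.pi + Real.pi / 2) ∧ Y a₁ = Y b₁ := by
    rcases le_total (Y (Real.pi + Real.pi / 2)) (Y (Real.pi / 2)) with h | h
    · have hlt : Y (Real.pi / 2) ≤ Y Real.pi :=
        (hup ⟨by linarith, by linarith⟩ ⟨by linarith, le_rfl⟩ (by linarith)).le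
      obtain ⟨b, hb, hbe⟩ := intermediate_value_Icc' (show Real.pi ≤ Real.pi + Real.pi / 2 by
        linarith) hYc.continuousOn ⟨h, hlt⟩
      exact ⟨Real.pi / 2, b, ⟨le_rfl, by linarith⟩, hb, hbe.symm⟩
    · have hlt : Y (Real.pi + Real.pi / 2) < Y Real.pi :=
        hdown ⟨le_rfl, by linarith⟩ ⟨by linarith, by linarith⟩ (by linarith)
      obtain ⟨a, ha, hae⟩ := intermediate_value_Ico (show Real.pi / 2 ≤ Real.pi by linarith)
        hYc.continuousOn ⟨h, hlt⟩
      exact ⟨a, _, ha, ⟨by linarith, le_rfl⟩, hae⟩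
  have hX₁ : X b₁ ≤ X a₁ :=
    hback.antitoneOn ⟨ha₁.1, by linarith [ha₁.2]⟩ ⟨by linarith [hb₁.1], hb₁.2⟩
      (by linarith [ha₁.2, hb₁.1])
  set S : Set (ℝ × ℝ) := (Icc 0 a₁ ×ˢ Icc Real.pi (2 * Real.pi)) ∩ {p | Y p.1 = Y p.2} with hS
  have hSc : IsCompact S := (isCompact_Icc.prod isCompact_Icc).inter_right
    (isClosed_eq (hYc.comp continuous_fst) (hYc.comp continuous_snd))
  have hP : IsClosed (Prod.fst '' (S ∩ {p | X p.1 ≤ X p.2})) :=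
    ((hSc.inter_right (isClosed_le (hXc.comp continuous_fst) (hXc.comp continuous_snd))).image
      continuous_fst).isClosed
  have hQ : IsClosed (Prod.fst '' (S ∩ {p | X p.2 ≤ X p.1})) :=
    ((hSc.inter_right (isClosed_le (hXc.comp continuous_snd) (hXc.comp continuous_fst))).image
      continuous_fst).isClosed
  have ha₁0 : 0 ≤ a₁ := by linarith [ha₁.1]
  have hcover : Icc 0 a₁ ⊆ Prod.fst '' (S ∩ {p | X p.1 ≤ X p.2}) ∪
      Prod.fst '' (S ∩ {p | X p.2 ≤ X p.1}) := by
    intro a ha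
    have h₁ : Y (2 * Real.pi) ≤ Y a := hY0 ▸ hup.monotoneOn ⟨le_rfl, hpi.le⟩
      ⟨ha.1, ha.2.trans ha₁.2.le⟩ ha.1
    have h₂ : Y a ≤ Y Real.pi := hup.monotoneOn ⟨ha.1, ha.2.trans ha₁.2.le⟩
      ⟨hpi.le, le_rfl⟩ (ha.2.trans ha₁.2.le)
    obtain ⟨b, hb, hbe⟩ := intermediate_value_Icc' (show Real.pi ≤ 2 * Real.pi by linarith)
      hYc.continuousOn ⟨h₁, h₂⟩
    rcases le_total (X a) (X b) with h | h
    · exact Or.inl ⟨(a, b), ⟨⟨⟨ha, hb⟩, hbe.symm⟩, h⟩, rfl⟩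
    · exact Or.inr ⟨(a, b), ⟨⟨⟨ha, hb⟩, hbe.symm⟩, h⟩, rfl⟩
  obtain ⟨a, ha, ⟨⟨p, hp, hpa⟩, ⟨q, hq, hqa⟩⟩⟩ := isPreconnected_closed_iff.1
    (isPreconnected_Icc (a := (0 : ℝ)) (b := a₁)) _ _ hP hQ hcover
    ⟨0, ⟨le_rfl, ha₁0⟩, (0, 2 * Real.pi),
      ⟨⟨⟨⟨le_rfl, ha₁0⟩, ⟨by linarith, le_rfl⟩⟩, hY0⟩, hX0⟩, rfl⟩
    ⟨a₁, ⟨ha₁0, le_rfl⟩, (a₁, b₁),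
      ⟨⟨⟨⟨ha₁0, le_rfl⟩, ⟨hb₁.1, by linarith [hb₁.2]⟩⟩, hab₁⟩, hX₁⟩, rfl⟩
  obtain ⟨p₁, p₂⟩ := p
  obtain ⟨q₁, q₂⟩ := q
  obtain rfl : p₁ = a := hpa
  obtain rfl : q₁ = p₁ := hqa
  obtain ⟨⟨⟨-, hp₂⟩, hpY⟩, hpX⟩ := hp
  obtain ⟨⟨⟨-, hq₂⟩, hqY⟩, hqX⟩ := hq
  simp only [mem_ofPred_eq] at hpY hpX hqY hqX hp₂ hq₂
  obtain rfl : p₂ = q₂ := hdown.injOn hp₂ hq₂ (hpY.symm.trans hqY)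
  exact ⟨q₁, p₂, by linarith [ha.2, ha₁.2, hp₂.1], by linarith [ha.1, hp₂.2],
    le_antisymm hpX hqX, hpY⟩

lemma exists_zero_deriv_nonpos {g g' : ℝ → ℝ} {a b : ℝ} (hg : ∀ x, HasDerivAt g (g' x) x)
    (hab : a < b) (ha : 0 ≤ g a) (hb : g b ≤ 0) : ∃ z, g z = 0 ∧ g' z ≤ 0 := by
  by_contra! hno
  have hnn : ∀ x ∈ Icc a b, 0 ≤ g x := fun x hx =>
    image_le_of_deriv_right_lt_deriv_boundary (f := fun _ => 0) (f' := fun _ => 0)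
      continuousOn_const (fun x _ => hasDerivWithinAt_const x _ 0) ha hg
      (fun x _ hx => hno x hx.symm) hx
  have hb0 : g b = 0 := le_antisymm hb (hnn b (right_mem_Icc.2 hab.le))
  have hpos := hno b hb0
  have hs := (hasDerivAt_iff_tendsto_slope.1 (hg b)).mono_left
    (nhdsWithin_mono b (fun t (ht : t ∈ Iio b) => ht.ne))
  have : g' b ≤ 0 := by
    apply le_of_tendsto hs
    filter_upwards [Ioo_mem_nhdsLT hab] with t ht
    rw [slope_def_field, hb0]
    exact div_nonpos_of_nonneg_of_nonpos (by linarith [hnn t ⟨ht.1.le, ht.2.le⟩])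
      (by linarith [ht.2])
  linarith

/-- A closed locally convex curve parametrized by its tangent angle passes twice through some point
within one full turn. -/
theorem exists_eq_within_full_turn {G : ℝ → E2} {r : ℝ → ℝ} {T : ℝ} (hr : ∀ x, 0 < r x)
    (hG : ∀ x, HasDerivAt G (r x • dirVec x) x) (hT : 0 < T)
    (hper : Function.Periodic G T) (hdir : Function.Periodic dirVec T) :
    ∃ a b, a < b ∧ b ≤ a + 2 * Real.pi ∧ G a = G b := by
  have hpi := Real.pi_pos
  have hGc : Continuous G := continuous_iff_continuousAt.2 fun x => (hG x).continuousAt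
  set p : ℝ → ℝ := fun x => cross2 (dirVec x) (G x) with hp
  have hpc : Continuous p := by
    have h0 : Continuous fun x => G x 0 := (EuclideanSpace.proj (𝕜 := ℝ) 0).continuous.comp hGc
    have h1 : Continuous fun x => G x 1 := (EuclideanSpace.proj (𝕜 := ℝ) 1).continuous.comp hGc
    exact (Real.continuous_cos.mul h1).sub (Real.continuous_sin.mul h0)
  have hpp : Function.Periodic p T := fun x => by simp only [hp, hper x, hdir x]
  obtain ⟨m, -, hm⟩ := (isCompact_Icc (a := (0 : ℝ)) (b := 0 + T)).exists_isMaxOn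
    ⟨0, le_rfl, by linarith⟩ hpc.continuousOn
  have hmax : ∀ x, p x ≤ p m := by
    intro x
    obtain ⟨y, hy, hxy⟩ := hpp.exists_mem_Ico hT x 0
    rw [hxy]
    exact hm (Ico_subset_Icc_self hy)
  have hturn : ∀ x, dirVec (x + 2 * Real.pi) = dirVec x := fun x => by
    simp [dirVec]
  set g : ℝ → ℝ := fun x => cross2 (dirVec x) (G (x + 2 * Real.pi) - G x) with hgdef
  have hgp : ∀ x, g x = p (x + 2 * Real.pi) - p x := fun x => by
    simp only [hgdef, hp, cross2_sub_right, hturn]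
  have hsh : ∀ x, HasDerivAt (fun x => G (x + 2 * Real.pi))
      (r (x + 2 * Real.pi) • dirVec x) x := fun x => by
    have := (hG (x + 2 * Real.pi)).comp_add_const x (2 * Real.pi)
    rwa [hturn] at this
  have hg : ∀ x, HasDerivAt g (-(Real.cos x * (G (x + 2 * Real.pi) - G x) 0 +
      Real.sin x * (G (x + 2 * Real.pi) - G x) 1)) x := by
    intro x
    have hD := (hsh x).sub (hG x)
    have h := ((Real.hasDerivAt_cos x).mul (hD.apply_euclidean 1)).sub
      ((Real.hasDerivAt_sin x).mul (hD.apply_euclidean 0))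
    refine h.congr_deriv ?_
    simp only [PiLp.sub_apply, PiLp.smul_apply, smul_eq_mul, dirVec_zero, dirVec_one, Pi.sub_apply]
    ring
  obtain ⟨z, hz₁, hz₂⟩ := exists_zero_deriv_nonpos hg (a := m - 2 * Real.pi) (b := m)
    (by linarith) (by rw [hgp, sub_add_cancel]; linarith [hmax (m - 2 * Real.pi)])
    (by rw [hgp]; linarith [hmax (m + 2 * Real.pi)])
  have hshz : ∀ x, HasDerivAt (fun x => G (z + x)) (r (z + x) • dirVec (z + x)) x := fun x =>
    (hG (z + x)).comp_const_add z x
  obtain ⟨a, b, hab, hba, hX, hY⟩ := exists_self_intersection (r := fun x => r (z + x))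
    (X := fun x => Real.cos z * G (z + x) 0 + Real.sin z * G (z + x) 1)
    (Y := fun x => Real.cos z * G (z + x) 1 - Real.sin z * G (z + x) 0) (fun x => hr _)
    (fun x => by
      refine ((((hshz x).apply_euclidean 0).const_mul (Real.cos z)).add
        (((hshz x).apply_euclidean 1).const_mul (Real.sin z))).congr_deriv ?_
      have e : Real.cos x = Real.cos (z + x - z) := by ring_nf
      rw [e, Real.cos_sub]
      simp only [PiLp.smul_apply, smul_eq_mul, dirVec_zero, dirVec_one]
      ring)
    (fun x => by
      refine ((((hshz x).apply_euclidean 1).const_mul (Real.cos z)).sub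
        (((hshz x).apply_euclidean 0).const_mul (Real.sin z))).congr_deriv ?_
      have e : Real.sin x = Real.sin (z + x - z) := by ring_nf
      rw [e, Real.sin_sub]
      simp only [PiLp.smul_apply, smul_eq_mul, dirVec_zero, dirVec_one]
      ring)
    (by simp only [PiLp.sub_apply] at hz₂; simp only [add_zero]; linarith)
    (by
      simp only [hgdef, cross2, PiLp.sub_apply, dirVec_zero, dirVec_one] at hz₁
      simp only [add_zero]; linarith)
  refine ⟨z + a, z + b, by linarith, by linarith, ?_⟩
  have hcs := Real.cos_sq_add_sin_sq z
  have e0 : G (z + a) 0 = G (z + b) 0 := by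
    linear_combination Real.cos z * hX - Real.sin z * hY -
      (G (z + a) 0 - G (z + b) 0) * hcs
  have e1 : G (z + a) 1 = G (z + b) 1 := by
    linear_combination Real.sin z * hX + Real.cos z * hY -
      (G (z + a) 1 - G (z + b) 1) * hcs
  ext i
  fin_cases i
  · exact e0
  · exact e1

lemma exists_pos_smul_dirVec {v : E2} (hv : v ≠ 0) : ∃ R θ : ℝ, 0 < R ∧ v = R • dirVec θ := by
  refine ⟨‖(⟨v 0, v 1⟩ : ℂ)‖, Complex.arg ⟨v 0, v 1⟩, ?_, ?_⟩
  · rw [norm_pos_iff]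
    intro h
    apply hv
    ext i
    fin_cases i
    · exact congrArg Complex.re h
    · exact congrArg Complex.im h
  · ext i
    fin_cases i
    · simp
    · simp

lemma ContDiff.apply_euclidean {f : ℝ → E2} {n : WithTop ℕ∞} (hf : ContDiff ℝ n f) (i : Fin 2) :
    ContDiff ℝ n fun t => f t i :=
  contDiff_euclidean.1 hf i

lemma sq_add_sq_pos_of_ne_zero {v : E2} (hv : v ≠ 0) : 0 < v 0 ^ 2 + v 1 ^ 2 := by
  obtain ⟨R, θ, hR, rfl⟩ := exists_pos_smul_dirVec hv
  have : (R • dirVec θ) 0 ^ 2 + (R • dirVec θ) 1 ^ 2 = R ^ 2 := by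
    simp only [PiLp.smul_apply, smul_eq_mul, dirVec_zero, dirVec_one]
    linear_combination R ^ 2 * Real.cos_sq_add_sin_sq θ
  rw [this]
  positivity

lemma ContDiff.deriv_infty {E : Type*} [NormedAddCommGroup E] [NormedSpace ℝ E] {f : ℝ → E}
    (hf : ContDiff ℝ (⊤ : ℕ∞) f) : ContDiff ℝ (⊤ : ℕ∞) (deriv f) :=
  (contDiff_infty_iff_deriv.1 hf).2

/-- The tangent angle of a regular smooth plane curve. -/
theorem exists_tangent_angle {β : ℝ → E2} (hβ : ContDiff ℝ (⊤ : ℕ∞) β)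
    (hreg : ∀ t, deriv β t ≠ 0) :
    ∃ φ A : ℝ → ℝ, ContDiff ℝ (⊤ : ℕ∞) φ ∧ ContDiff ℝ (⊤ : ℕ∞) A ∧
      (∀ t, HasDerivAt φ (cross2 (deriv β t) (deriv (deriv β) t) /
        ((deriv β t) 0 ^ 2 + (deriv β t) 1 ^ 2)) t) ∧
      (∀ t, 0 < A t) ∧ ∀ t, deriv β t = A t • dirVec (φ t) := by
  have hβ₁ := hβ.deriv_infty
  have hβ₂ := hβ₁.deriv_infty
  have hq : ∀ t, 0 < (deriv β t) 0 ^ 2 + (deriv β t) 1 ^ 2 := fun t =>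
    sq_add_sq_pos_of_ne_zero (hreg t)
  obtain ⟨R, θ, hR, hθ⟩ := exists_pos_smul_dirVec (hreg 0)
  set w : ℝ → ℝ := fun t => cross2 (deriv β t) (deriv (deriv β) t) /
        ((deriv β t) 0 ^ 2 + (deriv β t) 1 ^ 2) with hw
  have hwc : ContDiff ℝ (⊤ : ℕ∞) w :=
    (((hβ₁.apply_euclidean 0).mul (hβ₂.apply_euclidean 1)).sub
      ((hβ₁.apply_euclidean 1).mul (hβ₂.apply_euclidean 0))).div
      (((hβ₁.apply_euclidean 0).pow 2).add ((hβ₁.apply_euclidean 1).pow 2)) fun t => (hq t).ne'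
  set φ : ℝ → ℝ := fun t => θ + ∫ u in (0 : ℝ)..t, w u with hφ
  have hφd : ∀ t, HasDerivAt φ (w t) t := fun t =>
    (hwc.continuous.integral_hasStrictDerivAt 0 t).hasDerivAt.const_add θ
  have hφs : ContDiff ℝ (⊤ : ℕ∞) φ := by
    rw [contDiff_infty_iff_deriv]
    exact ⟨fun t => (hφd t).differentiableAt, by rwa [funext fun t => (hφd t).deriv]⟩
  have hcos : ContDiff ℝ (⊤ : ℕ∞) fun t => Real.cos (φ t) := Real.contDiff_cos.comp hφs
  have hsin : ContDiff ℝ (⊤ : ℕ∞) fun t => Real.sin (φ t) := Real.contDiff_sin.comp hφs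
  set A : ℝ → ℝ := fun t => deriv β t 0 * Real.cos (φ t) + deriv β t 1 * Real.sin (φ t) with hA
  set B : ℝ → ℝ := fun t => deriv β t 1 * Real.cos (φ t) - deriv β t 0 * Real.sin (φ t) with hB
  have hAs : ContDiff ℝ (⊤ : ℕ∞) A :=
    ((hβ₁.apply_euclidean 0).mul hcos).add ((hβ₁.apply_euclidean 1).mul hsin)
  have hφ0 : φ 0 = θ := by simp [hφ]
  have hA0 : A 0 = R := by
    simp only [hA, hθ, hφ0, PiLp.smul_apply, smul_eq_mul, dirVec_zero, dirVec_one]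
    linear_combination R * Real.cos_sq_add_sin_sq θ
  have hB0 : B 0 = 0 := by
    simp only [hB, hθ, hφ0, PiLp.smul_apply, smul_eq_mul, dirVec_zero, dirVec_one]
    ring
  have hd : ∀ i t, HasDerivAt (fun t => deriv β t i) (deriv (deriv β) t i) t := fun i t =>
    ((hβ₁.differentiable (by simp)) t).hasDerivAt.apply_euclidean i
  have hquot : ∀ t, HasDerivAt (fun t => B t ^ 2 / ((deriv β t) 0 ^ 2 + (deriv β t) 1 ^ 2)) 0 t := by
    intro t
    have h₁ : HasDerivAt B (B t * (deriv β t 0 * deriv (deriv β) t 0 +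
        deriv β t 1 * deriv (deriv β) t 1) / ((deriv β t) 0 ^ 2 + (deriv β t) 1 ^ 2)) t := by
      refine (((hd 1 t).mul (hφd t).cos).sub ((hd 0 t).mul (hφd t).sin)).congr_deriv ?_
      have := (hq t).ne'
      simp only [hB, hw, cross2]
      field_simp
      ring
    refine ((h₁.pow 2).div (((hd 0 t).pow 2).add ((hd 1 t).pow 2)) (hq t).ne').congr_deriv ?_
    have := (hq t).ne'
    simp only [Pi.pow_apply, Pi.add_apply]
    field_simp
    ring
  have hBz : ∀ t, B t = 0 := by
    intro t
    have h := is_const_of_deriv_eq_zero (fun t => (hquot t).differentiableAt)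
      (fun t => (hquot t).deriv) t 0
    simp only [hB0] at h
    rw [zero_pow two_ne_zero, zero_div, div_eq_zero_iff] at h
    exact pow_eq_zero_iff two_ne_zero |>.1 (h.resolve_right (hq t).ne')
  have hcs := fun t => Real.cos_sq_add_sin_sq (φ t)
  have h0 : ∀ t, deriv β t 0 = A t * Real.cos (φ t) := fun t => by
    have := hBz t
    simp only [hB, hA] at this ⊢
    linear_combination -Real.sin (φ t) * this - deriv β t 0 * hcs t
  have h1 : ∀ t, deriv β t 1 = A t * Real.sin (φ t) := fun t => by
    have := hBz t
    simp only [hB, hA] at this ⊢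
    linear_combination Real.cos (φ t) * this - deriv β t 1 * hcs t
  have hAne : ∀ t, A t ≠ 0 := by
    intro t hz
    apply hreg t
    ext i
    fin_cases i
    · simpa [hz] using h0 t
    · simpa [hz] using h1 t
  refine ⟨φ, A, hφs, hAs, hφd, fun t => ?_, fun t => ?_⟩
  · by_contra! hneg
    obtain ⟨z, hz⟩ := mem_range_of_exists_le_of_exists_ge hAs.continuous ⟨t, hneg⟩
      ⟨0, hA0 ▸ hR.le⟩
    exact hAne z hz
  · ext i
    fin_cases i
    · simpa using h0 t
    · simpa using h1 t

/-- `G` is a reparametrization of the closed curve `γ` by its tangent angle, with radius of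
curvature `r`; the angle at the parameter `s` is `Φ s`. -/
structure IsAngleParam (γ G : ℝ → E2) (r Φ Ψ : ℝ → ℝ) : Prop where
  radius_pos : ∀ x, 0 < r x
  radius_smooth : ContDiff ℝ (⊤ : ℕ∞) r
  angle_smooth : ContDiff ℝ (⊤ : ℕ∞) Φ
  symm_smooth : ContDiff ℝ (⊤ : ℕ∞) Ψ
  angle_symm : ∀ x, Φ (Ψ x) = x
  symm_angle : ∀ s, Ψ (Φ s) = s
  eq_comp : ∀ s, γ s = G (Φ s)
  hasDerivAt : ∀ x, HasDerivAt G (r x • dirVec x) x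
  eq_iff : ∀ x y, G x = G y ↔ ∃ k : ℤ, y = x + k * (2 * Real.pi)

theorem exists_isAngleParam_of_cross2_pos {β : ℝ → E2} (hβ : ContDiff ℝ (⊤ : ℕ∞) β)
    (hreg : ∀ t, deriv β t ≠ 0) (hpos : ∀ t, 0 < cross2 (deriv β t) (deriv (deriv β) t))
    (hinj : ∀ s t, β s = β t ↔ ∃ k : ℤ, t = s + k) :
    ∃ G r Φ Ψ, IsAngleParam β G r Φ Ψ := by
  obtain ⟨φ, A, hφs, hAs, hφd, hA, hβφ⟩ := exists_tangent_angle hβ hreg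
  have hφpos : ∀ t, 0 < deriv φ t := fun t => by
    rw [(hφd t).deriv]
    exact div_pos (hpos t) (sq_add_sq_pos_of_ne_zero (hreg t))
  have hmono : StrictMono φ := strictMono_of_deriv_pos hφpos
  have hper : ∀ t, β (t + 1) = β t := fun t => ((hinj t (t + 1)).2 ⟨1, by simp⟩).symm
  have hper₁ : ∀ t, deriv β (t + 1) = deriv β t := fun t => by
    rw [← deriv_comp_add_const, funext hper]
  have hper₂ : ∀ t, deriv (deriv β) (t + 1) = deriv (deriv β) t := fun t => by
    rw [← deriv_comp_add_const, funext hper₁]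
  obtain ⟨T, hTdef⟩ : ∃ T, T = φ 1 - φ 0 := ⟨_, rfl⟩
  have hT : 0 < T := by rw [hTdef]; linarith [hmono zero_lt_one]
  have hφ1 : ∀ t, φ (t + 1) = φ t + T := by
    intro t
    have hd : ∀ t, HasDerivAt (fun t => φ (t + 1) - φ t) 0 t := fun t => by
      have h := ((hφd (t + 1)).comp_add_const t 1).sub (hφd t)
      rw [hper₁, hper₂, sub_self] at h
      exact h
    have h := is_const_of_deriv_eq_zero (fun t => (hd t).differentiableAt)
      (fun t => (hd t).deriv) t 0
    simp only [zero_add, ← hTdef] at h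
    linarith
  have hφk : ∀ (k : ℤ) t, φ (t + k) = φ t + k * T := by
    intro k
    induction k using Int.induction_on with
    | zero => intro t; simp
    | succ n ih =>
      intro t
      have := hφ1 (t + n)
      push_cast at ih ⊢
      rw [← add_assoc, this, ih]
      ring
    | pred n ih =>
      intro t
      have := hφ1 (t + (-n - 1))
      push_cast at ih ⊢
      rw [show t + (-(n : ℝ) - 1) + 1 = t + -n by ring, ih] at this
      linarith
  have hsurj : Function.Surjective φ := by
    intro y
    obtain ⟨n, hn⟩ := exists_nat_gt (|y - φ 0| / T)
    rw [div_lt_iff₀ hT, abs_lt] at hn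
    have h₁ := hφk n 0
    have h₂ := hφk (-n) 0
    push_cast at h₁ h₂
    exact mem_range_of_exists_le_of_exists_ge hφs.continuous ⟨_, by rw [h₂]; linarith⟩
      ⟨_, by rw [h₁]; linarith⟩
  set e : ℝ ≃ₜ ℝ := (hmono.orderIsoOfSurjective φ hsurj).toHomeomorph with he
  have hes : ∀ x, φ (e.symm x) = x := fun x => e.apply_symm_apply x
  have hse : ∀ t, e.symm (φ t) = t := fun t => e.symm_apply_apply t
  have hesm : ContDiff ℝ (⊤ : ℕ∞) e.symm :=
    Homeomorph.contDiff_symm_deriv e (f' := deriv φ) (fun t => (hφpos t).ne')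
      (fun t => (hφd t).differentiableAt.hasDerivAt) hφs
  have hesd : ∀ x, HasDerivAt e.symm (deriv φ (e.symm x))⁻¹ x := fun x =>
    HasDerivAt.of_local_left_inverse e.symm.continuous.continuousAt
      (hφd _).differentiableAt.hasDerivAt (hφpos _).ne' (Eventually.of_forall hes)
  set r : ℝ → ℝ := fun x => A (e.symm x) / deriv φ (e.symm x) with hr
  have hrpos : ∀ x, 0 < r x := fun x => div_pos (hA _) (hφpos _)
  have hG : ∀ x, HasDerivAt (fun x => β (e.symm x)) (r x • dirVec x) x := by
    intro x
    have h := HasDerivAt.scomp x ((hβ.differentiable (by simp) (e.symm x)).hasDerivAt) (hesd x)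
    rw [hβφ, hes, smul_smul, inv_mul_eq_div] at h
    exact h
  have hGT : ∀ x y, β (e.symm x) = β (e.symm y) ↔ ∃ k : ℤ, y = x + k * T := by
    intro x y
    rw [hinj]
    refine exists_congr fun k => ⟨fun h => ?_, fun h => ?_⟩
    · rw [← hes y, h, hφk, hes]
    · rw [h]
      apply hmono.injective
      rw [hes, hφk, hes]
  have hdir : Function.Periodic dirVec T := by
    intro x
    have hx := hβφ (e.symm x)
    have hx1 := hβφ (e.symm x + 1)
    rw [hper₁, hφ1, hes] at hx1
    rw [hes] at hx
    have h := hx.symm.trans hx1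
    have h0 : A (e.symm x) * Real.cos x = A (e.symm x + 1) * Real.cos (x + T) :=
      congrArg (fun v : E2 => v 0) h
    have h1 : A (e.symm x) * Real.sin x = A (e.symm x + 1) * Real.sin (x + T) :=
      congrArg (fun v : E2 => v 1) h
    have hsq : A (e.symm x) ^ 2 = A (e.symm x + 1) ^ 2 := by
      have c₁ := Real.cos_sq_add_sin_sq x
      have c₂ := Real.cos_sq_add_sin_sq (x + T)
      linear_combination -A (e.symm x) ^ 2 * c₁ + A (e.symm x + 1) ^ 2 * c₂ +
        (A (e.symm x) * Real.cos x + A (e.symm x + 1) * Real.cos (x + T)) * h0 +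
        (A (e.symm x) * Real.sin x + A (e.symm x + 1) * Real.sin (x + T)) * h1
    have hAA := (sq_eq_sq₀ (hA _).le (hA _).le).1 hsq
    rw [← hAA] at h
    exact (smul_right_injective E2 (hA _).ne' h).symm
  have hT2 : T = 2 * Real.pi := by
    obtain ⟨a, b, hab, hba, hGab⟩ := exists_eq_within_full_turn hrpos hG hT
      (fun x => ((hGT x (x + T)).2 ⟨1, by simp⟩).symm) hdir
    obtain ⟨k, hk⟩ := (hGT a b).1 hGab
    have hk0 : (0 : ℝ) < k := pos_of_mul_pos_left (b := T) (by linarith) hT.le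
    have hk1 : (1 : ℝ) ≤ k := by exact_mod_cast Int.add_one_le_iff.2 (Int.cast_pos.1 hk0)
    have hle : T ≤ 2 * Real.pi := by nlinarith
    have hcos : Real.cos T = 1 := by
      have h := congrArg (fun v : E2 => v 0) (hdir 0)
      simpa using h
    obtain ⟨n, hn⟩ := (Real.cos_eq_one_iff T).1 hcos
    have h2pi := Real.two_pi_pos
    have hn0 : (0 : ℝ) < n := pos_of_mul_pos_left (b := 2 * Real.pi) (by linarith) h2pi.le
    have hn1 : (1 : ℝ) ≤ n := by exact_mod_cast Int.add_one_le_iff.2 (Int.cast_pos.1 hn0)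
    nlinarith
  refine ⟨fun x => β (e.symm x), r, φ, e.symm, hrpos, ?_, hφs, hesm, hes, hse, fun s => ?_, hG, ?_⟩
  · exact (hAs.comp hesm).div (hφs.deriv_infty.comp hesm) fun x => (hφpos _).ne'
  · simp only [hse]
  · rw [← hT2]
    exact hGT

lemma IsAngleParam.comp_neg {γ G : ℝ → E2} {r Φ Ψ : ℝ → ℝ}
    (h : IsAngleParam (fun t => γ (-t)) G r Φ Ψ) :
    IsAngleParam γ G r (fun s => Φ (-s)) (fun x => -Ψ x) where
  radius_pos := h.radius_pos
  radius_smooth := h.radius_smooth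
  angle_smooth := h.angle_smooth.comp contDiff_neg
  symm_smooth := h.symm_smooth.neg
  angle_symm x := by rw [neg_neg, h.angle_symm]
  symm_angle s := by rw [h.symm_angle, neg_neg]
  eq_comp s := by rw [← h.eq_comp, neg_neg]
  hasDerivAt := h.hasDerivAt
  eq_iff := h.eq_iff

lemma eq_iff_of_periodic_of_injOn {γ : ℝ → E2} (hper : Function.Periodic γ 1)
    (hinj : InjOn γ (Ico (0 : ℝ) 1)) (s t : ℝ) : γ s = γ t ↔ ∃ k : ℤ, t = s + k := by
  constructor
  · intro h
    have hfr : ∀ s, γ (Int.fract s) = γ s := fun s => by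
      have := hper.sub_int_mul_eq (x := s) ⌊s⌋
      rwa [mul_one] at this
    have hmem : ∀ s : ℝ, Int.fract s ∈ Ico (0 : ℝ) 1 := fun s =>
      ⟨Int.fract_nonneg s, Int.fract_lt_one s⟩
    have := hinj (hmem s) (hmem t) (by rw [hfr, hfr, h])
    refine ⟨⌊t⌋ - ⌊s⌋, ?_⟩
    have h₁ := Int.fract_add_floor s
    have h₂ := Int.fract_add_floor t
    push_cast
    linarith
  · rintro ⟨k, rfl⟩
    have := hper.int_mul k s
    rw [mul_one] at this
    exact this.symm

theorem PlaneCurve.IsConvexCurve.exists_isAngleParam {M : PlaneCurve} (hM : M.IsConvexCurve) :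
    ∃ G r Φ Ψ, IsAngleParam M.γ G r Φ Ψ := by
  obtain ⟨hper, hinj, hcurv⟩ := hM
  have heq := eq_iff_of_periodic_of_injOn hper hinj
  have hs₁ := M.smooth.deriv_infty
  have hs₂ := hs₁.deriv_infty
  set q : ℝ → ℝ := fun t => cross2 (deriv M.γ t) (deriv (deriv M.γ) t) with hq
  have hqc : Continuous q :=
    (((hs₁.apply_euclidean 0).mul (hs₂.apply_euclidean 1)).sub
      ((hs₁.apply_euclidean 1).mul (hs₂.apply_euclidean 0))).continuous
  have hq0 : ∀ t, q t ≠ 0 := fun t h => hcurv t (by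
    simp only [hq] at h
    rw [curvature, h, zero_div])
  by_cases hpos : ∀ t, 0 < q t
  · exact exists_isAngleParam_of_cross2_pos M.smooth M.regular hpos heq
  · push Not at hpos
    have hneg : ∀ t, q t < 0 := by
      intro t
      by_contra! h
      obtain ⟨z, hz⟩ := mem_range_of_exists_le_of_exists_ge hqc hpos ⟨t, h⟩
      exact hq0 z hz
    have h₁ : deriv (fun t => M.γ (-t)) = fun t => -deriv M.γ (-t) := funext fun t =>
      deriv_comp_neg (f := M.γ) t
    have h₂ : ∀ t, deriv (deriv fun t => M.γ (-t)) t = deriv (deriv M.γ) (-t) := fun t => by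
      rw [h₁, deriv.fun_neg, deriv_comp_neg, neg_neg]
    obtain ⟨G, r, Φ, Ψ, h⟩ := exists_isAngleParam_of_cross2_pos (β := fun t => M.γ (-t))
      (M.smooth.comp contDiff_neg) (fun t => by rw [h₁]; exact neg_ne_zero.2 (M.regular _))
      (fun t => by
        have := hneg (-t)
        rw [h₂, h₁]
        simp only [hq, cross2, PiLp.neg_apply] at this ⊢
        linarith)
      (fun s t => by
        rw [heq]
        constructor
        · rintro ⟨k, hk⟩
          exact ⟨-k, by push_cast; linarith⟩
        · rintro ⟨k, hk⟩
          exact ⟨-k, by push_cast; linarith⟩)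
    exact ⟨G, r, _, _, h.comp_neg⟩

/-- On a convex arc turning by less than `π`, the chord from `a` to `b` is to the left of the
tangent at `a`. -/
lemma cross2_dirVec_chord_pos {H : ℝ → E2} {R : ℝ → ℝ} (hR : ∀ x, 0 < R x)
    (hH : ∀ x, HasDerivAt H (R x • dirVec x) x) {a b : ℝ} (hab : a < b) (hb : b ≤ a + Real.pi) :
    0 < cross2 (dirVec a) (H b - H a) := by
  have hmono : StrictMonoOn (fun x => cross2 (dirVec a) (H x)) (Icc a (a + Real.pi)) := by
    apply strictMonoOn_of_hasDerivAt_pos fun x => (hH x).cross2_const (dirVec a)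
    intro x hx
    rw [cross2_smul_right, cross2_dirVec]
    exact mul_pos (hR x) (Real.sin_pos_of_pos_of_lt_pi (by linarith [hx.1]) (by linarith [hx.2]))
  have := hmono ⟨le_rfl, by linarith⟩ ⟨hab.le, hb⟩ hab
  rw [cross2_sub_right]
  simp only at this
  linarith

/-- Consecutive chords of a convex arc turning by at most `π` turn left. -/
lemma cross2_chord_chord_pos {H : ℝ → E2} {R : ℝ → ℝ} (hR : ∀ x, 0 < R x)
    (hH : ∀ x, HasDerivAt H (R x • dirVec x) x) {a b c : ℝ} (hab : a < b) (hbc : b < c)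
    (hc : c ≤ a + Real.pi) : 0 < cross2 (H b - H a) (H c - H b) := by
  have hmono : StrictMonoOn (fun x => cross2 (H b - H a) (H x)) (Icc b c) := by
    apply strictMonoOn_of_hasDerivAt_pos fun x => (hH x).cross2_const (H b - H a)
    intro x hx
    have hanti : StrictAntiOn (fun t => cross2 (dirVec x) (H t)) (Icc a b) := by
      apply strictAntiOn_of_hasDerivAt_neg fun t => (hH t).cross2_const (dirVec x)
      intro t ht
      rw [cross2_smul_right, cross2_dirVec]
      exact mul_neg_of_pos_of_neg (hR t)
        (Real.sin_neg_of_neg_of_neg_pi_lt (by linarith [hx.1, ht.2]) (by linarith [hx.2, ht.1]))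
    have := hanti (left_mem_Icc.2 hab.le) (right_mem_Icc.2 hab.le) hab
    rw [cross2_smul_right, cross2_swap, cross2_sub_right]
    simp only at this
    exact mul_pos (hR x) (by linarith)
  have := hmono (left_mem_Icc.2 hbc.le) (right_mem_Icc.2 hbc.le) hbc
  rw [cross2_sub_right]
  simp only at this
  linarith

lemma surjective_smul_add_smul_iff {L : ℝ × ℝ → E2} {p q : E2} (hq : q ≠ 0)
    (hL : ∀ z, L z = z.1 • p + z.2 • q) : Function.Surjective L ↔ cross2 p q ≠ 0 := by
  constructor
  · intro h h0
    obtain ⟨z, hz⟩ := h !₂[-(q 1), q 0]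
    have hpos := sq_add_sq_pos_of_ne_zero hq
    have e0 : z.1 * p 0 + z.2 * q 0 = -(q 1) := by
      have := congrArg (fun v : E2 => v 0) ((hL z).symm.trans hz)
      simpa using this
    have e1 : z.1 * p 1 + z.2 * q 1 = q 0 := by
      have := congrArg (fun v : E2 => v 1) ((hL z).symm.trans hz)
      simpa using this
    have : (q 0) ^ 2 + (q 1) ^ 2 = 0 := by
      simp only [cross2] at h0
      linear_combination -z.1 * h0 + q 1 * e0 - q 0 * e1
    linarith
  · intro h v
    refine ⟨(cross2 v q / cross2 p q, cross2 p v / cross2 p q), ?_⟩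
    rw [hL]
    ext i
    fin_cases i <;> simp <;> field_simp <;> simp only [cross2] <;> ring

namespace IsAngleParam

variable {γ G : ℝ → E2} {r Φ Ψ : ℝ → ℝ}

lemma periodic (h : IsAngleParam γ G r Φ Ψ) : Function.Periodic G (2 * Real.pi) := fun x =>
  ((h.eq_iff x (x + 2 * Real.pi)).2 ⟨1, by simp⟩).symm

lemma add_pi_add_pi (h : IsAngleParam γ G r Φ Ψ) (x : ℝ) : G (x + Real.pi + Real.pi) = G x := by
  rw [add_assoc, ← two_mul]
  exact h.periodic x

lemma hasDerivAt_add_pi (h : IsAngleParam γ G r Φ Ψ) (x : ℝ) :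
    HasDerivAt (fun x => G (x + Real.pi)) (-r (x + Real.pi) • dirVec x) x := by
  have := (h.hasDerivAt (x + Real.pi)).comp_add_const x Real.pi
  rwa [dirVec_add_pi, smul_smul, mul_neg_one] at this

lemma radius_add_pi_add_pi (h : IsAngleParam γ G r Φ Ψ) (x : ℝ) :
    r (x + Real.pi + Real.pi) = r x := by
  have h₁ := (h.hasDerivAt_add_pi (x + Real.pi)).comp_add_const x Real.pi
  simp only [h.add_pi_add_pi] at h₁
  have h₂ := h₁.unique (h.hasDerivAt x)
  have h0 := congrArg (fun v : E2 => v 0) h₂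
  have h1 := congrArg (fun v : E2 => v 1) h₂
  simp only [PiLp.smul_apply, smul_eq_mul, dirVec_zero, dirVec_one, Real.cos_add_pi,
    Real.sin_add_pi] at h0 h1
  linear_combination Real.cos x * h0 + Real.sin x * h1 -
    (r (x + Real.pi + Real.pi) - r x) * Real.cos_sq_add_sin_sq x

lemma deriv_eq_smul (h : IsAngleParam γ G r Φ Ψ) (s : ℝ) :
    HasDerivAt γ ((deriv Φ s * r (Φ s)) • dirVec (Φ s)) s := by
  have hΦ := (h.angle_smooth.differentiable (by simp) s).hasDerivAt
  have := HasDerivAt.scomp s (h.hasDerivAt (Φ s)) hΦ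
  rw [smul_smul] at this
  exact this.congr_of_eventuallyEq (Eventually.of_forall h.eq_comp)

lemma deriv_angle_ne_zero (h : IsAngleParam γ G r Φ Ψ) (s : ℝ) : deriv Φ s ≠ 0 := by
  have hΦ := (h.angle_smooth.differentiable (by simp) s).hasDerivAt
  have hΨ := (h.symm_smooth.differentiable (by simp) (Φ s)).hasDerivAt
  have := (hΨ.comp s hΦ).unique ((hasDerivAt_id s).congr_of_eventuallyEq
    (Eventually.of_forall h.symm_angle))
  exact right_ne_zero_of_mul_eq_one this

/-- The chord joining the point with tangent angle `x` to its antipode. -/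
def chord (G : ℝ → E2) (x : ℝ) : E2 := G (x + Real.pi) - G x

lemma hasDerivAt_chord (h : IsAngleParam γ G r Φ Ψ) (x : ℝ) :
    HasDerivAt (chord G) (-(r x + r (x + Real.pi)) • dirVec x) x := by
  refine ((h.hasDerivAt_add_pi x).sub (h.hasDerivAt x)).congr_deriv ?_
  rw [← sub_smul]
  ring_nf

lemma chord_add_pi (h : IsAngleParam γ G r Φ Ψ) (x : ℝ) :
    chord G (x + Real.pi) = (-1 : ℝ) • chord G x := by
  simp only [chord, h.add_pi_add_pi, neg_smul, one_smul, neg_sub]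

lemma cross2_dirVec_antipodal_chord_pos (h : IsAngleParam γ G r Φ Ψ) (x : ℝ) :
    0 < cross2 (dirVec x) (chord G x) :=
  cross2_dirVec_chord_pos h.radius_pos h.hasDerivAt (by linarith [Real.pi_pos]) le_rfl

lemma chord_ne_zero (h : IsAngleParam γ G r Φ Ψ) (x : ℝ) : chord G x ≠ 0 := by
  intro h0
  have := h.cross2_dirVec_antipodal_chord_pos x
  simp [h0, cross2] at this

lemma cross2_chord_chord_ne_zero (h : IsAngleParam γ G r Φ Ψ) {x y : ℝ} (hxy : x < y)
    (hy : y < x + Real.pi) : cross2 (chord G x) (chord G y) ≠ 0 := by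
  have hH : ∀ x, HasDerivAt (fun x => -chord G x) ((r x + r (x + Real.pi)) • dirVec x) x :=
    fun x => (h.hasDerivAt_chord x).neg.congr_deriv (by rw [neg_smul, neg_neg])
  have := cross2_chord_chord_pos (fun x => add_pos (h.radius_pos x) (h.radius_pos _)) hH hxy hy
    le_rfl
  simp only [h.chord_add_pi] at this
  intro h0
  simp only [cross2, PiLp.sub_apply, PiLp.neg_apply, PiLp.smul_apply, smul_eq_mul] at this h0
  linarith

lemma eq_add_int_mul_pi_of_chord_parallel (h : IsAngleParam γ G r Φ Ψ) {x y : ℝ}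
    (hxy : cross2 (chord G x) (chord G y) = 0) : ∃ k : ℤ, y = x + k * Real.pi := by
  have hper : Function.Periodic (fun y => cross2 (chord G x) (chord G y) = 0) Real.pi := fun y => by
    simp [h.chord_add_pi, cross2_smul_right, -neg_smul]
  have hz := hper.sub_int_mul_eq (x := y) ⌊(y - x) / Real.pi⌋
  have hz : cross2 (chord G x) (chord G (y - ⌊(y - x) / Real.pi⌋ * Real.pi)) = 0 := hz ▸ hxy
  have h₁ := (le_div_iff₀ Real.pi_pos).1 (Int.floor_le ((y - x) / Real.pi))
  have h₂ := (div_lt_iff₀ Real.pi_pos).1 (Int.lt_floor_add_one ((y - x) / Real.pi))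
  refine ⟨⌊(y - x) / Real.pi⌋, ?_⟩
  by_contra hne
  refine h.cross2_chord_chord_ne_zero (lt_of_le_of_ne (by linarith) fun he => hne ?_)
    (by linarith) hz
  linarith

/-- The midpoint of the parallel pair with tangent angle `x`. -/
def midpointCurve (G : ℝ → E2) (x : ℝ) : E2 := (1 / 2 : ℝ) • (G x + G (x + Real.pi))

theorem isHalfTurnCurve_midpointCurve (h : IsAngleParam γ G r Φ Ψ) :
    IsHalfTurnCurve (midpointCurve G) dirVec fun x => (r x - r (x + Real.pi)) / 2 where
  hasDerivAt x := by
    refine (((h.hasDerivAt x).add (h.hasDerivAt_add_pi x)).const_smul (1 / 2 : ℝ)).congr_deriv ?_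
    rw [← add_smul, smul_smul]
    ring_nf
  continuous_dir := contDiff_dirVec.continuous
  periodic x := by
    rw [midpointCurve, midpointCurve, h.add_pi_add_pi, add_comm (G (x + Real.pi))]
  parallel x y hxy := by
    rw [cross2_dirVec, Real.sin_eq_zero_iff] at hxy
    obtain ⟨k, hk⟩ := hxy
    exact ⟨k, by linarith⟩

/-- The ratio in which the envelope of the chords divides the chord with tangent angle `x`. -/
def chordRatio (r : ℝ → ℝ) (x : ℝ) : ℝ := r x / (r x + r (x + Real.pi))

/-- The point of contact of the chord with tangent angle `x` with the envelope of the chords. -/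
def chordEnvelope (G : ℝ → E2) (r : ℝ → ℝ) (x : ℝ) : E2 := G x + chordRatio r x • chord G x

lemma radius_add_radius_pos (h : IsAngleParam γ G r Φ Ψ) (x : ℝ) : 0 < r x + r (x + Real.pi) :=
  add_pos (h.radius_pos x) (h.radius_pos _)

lemma differentiable_chordRatio (h : IsAngleParam γ G r Φ Ψ) :
    Differentiable ℝ (chordRatio r) := by
  have hr : Differentiable ℝ r := h.radius_smooth.differentiable (by simp)
  have hr' : Differentiable ℝ fun x => r (x + Real.pi) := hr.comp (by fun_prop)
  exact hr.div (hr.add hr') fun x => (h.radius_add_radius_pos x).ne'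

theorem isHalfTurnCurve_chordEnvelope (h : IsAngleParam γ G r Φ Ψ) :
    IsHalfTurnCurve (chordEnvelope G r) (chord G) (deriv (chordRatio r)) where
  hasDerivAt x := by
    refine ((h.hasDerivAt x).add ((h.differentiable_chordRatio x).hasDerivAt.smul
      (h.hasDerivAt_chord x))).congr_deriv ?_
    have := (h.radius_add_radius_pos x).ne'
    have hr : chordRatio r x * -(r x + r (x + Real.pi)) = -r x := by
      rw [chordRatio]
      field_simp
    rw [smul_smul, hr, ← add_assoc, ← add_smul, add_neg_cancel, zero_smul, zero_add]
  continuous_dir := continuous_iff_continuousAt.2 fun x => (h.hasDerivAt_chord x).continuousAt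
  periodic x := by
    have := (h.radius_add_radius_pos x).ne'
    have hr : chordRatio r (x + Real.pi) = 1 - chordRatio r x := by
      rw [chordRatio, chordRatio, h.radius_add_pi_add_pi, add_comm (r (x + Real.pi))]
      field_simp
      ring
    rw [chordEnvelope, chordEnvelope, hr, h.chord_add_pi, chord]
    module
  parallel _ _ := h.eq_add_int_mul_pi_of_chord_parallel

section PlaneCurve

variable {M : PlaneCurve}

lemma eq_of_parallelParams (h : IsAngleParam M.γ G r Φ Ψ) {s t : ℝ} (hst : ParallelParams M s t) :
    M.γ t = G (Φ s + Real.pi) := by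
  obtain ⟨hne, hpar⟩ := hst
  rw [VParallel, (h.deriv_eq_smul s).deriv, (h.deriv_eq_smul t).deriv, cross2_smul_left,
    cross2_smul_right, cross2_dirVec, mul_eq_zero_iff_left, mul_eq_zero_iff_left,
    Real.sin_eq_zero_iff] at hpar
  · obtain ⟨n, hn⟩ := hpar
    rw [h.eq_comp, h.eq_iff]
    obtain ⟨k, rfl | rfl⟩ := Int.even_or_odd' n
    · refine absurd ?_ hne
      rw [h.eq_comp, h.eq_comp, h.eq_iff]
      exact ⟨k, by push_cast at hn; linarith⟩
    · exact ⟨-k, by push_cast at hn ⊢; linarith⟩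
  · exact mul_ne_zero (h.deriv_angle_ne_zero t) (h.radius_pos _).ne'
  · exact mul_ne_zero (h.deriv_angle_ne_zero s) (h.radius_pos _).ne'

lemma parallelParams (h : IsAngleParam M.γ G r Φ Ψ) (s : ℝ) :
    ParallelParams M s (Ψ (Φ s + Real.pi)) := by
  constructor
  · rw [h.eq_comp, h.eq_comp, h.angle_symm]
    intro heq
    have := h.chord_ne_zero (Φ s)
    exact this (sub_eq_zero.2 heq.symm)
  · rw [VParallel, (h.deriv_eq_smul s).deriv, (h.deriv_eq_smul _).deriv, cross2_smul_left,
      cross2_smul_right, cross2_dirVec, h.angle_symm, add_sub_cancel_left, Real.sin_pi, mul_zero,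
      mul_zero]

theorem eqd_eq_range (h : IsAngleParam M.γ G r Φ Ψ) : Eqd M (1 / 2) = range (midpointCurve G) := by
  ext p
  constructor
  · rintro ⟨_, _, ⟨s, t, rfl, rfl, hst⟩, rfl⟩
    refine ⟨Φ s, ?_⟩
    rw [h.eq_of_parallelParams hst, h.eq_comp s, midpointCurve]
    module
  · rintro ⟨x, rfl⟩
    refine ⟨_, _, ⟨Ψ x, _, rfl, rfl, h.parallelParams (Ψ x)⟩, ?_⟩
    rw [h.eq_comp, h.eq_comp, h.angle_symm, h.angle_symm, midpointCurve]
    module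

lemma chordFamily_eq (h : IsAngleParam M.γ G r Φ Ψ) {T : ℝ → ℝ}
    (hT : ∀ s, ParallelParams M s (T s)) :
    chordFamily M T = fun su => G (Φ su.1) + su.2 • chord G (Φ su.1) := by
  funext su
  rw [chordFamily, h.eq_of_parallelParams (hT su.1), h.eq_comp, chord]

lemma not_surjective_fderiv_iff (h : IsAngleParam M.γ G r Φ Ψ) (su : ℝ × ℝ) :
    ¬ Function.Surjective (fderiv ℝ
      (fun su : ℝ × ℝ => G (Φ su.1) + su.2 • chord G (Φ su.1)) su) ↔
      su.2 = chordRatio r (Φ su.1) := by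
  have hΦ := (h.angle_smooth.differentiable (by simp) su.1).hasDerivAt
  have h₁ := ((HasDerivAt.scomp su.1 (h.hasDerivAt (Φ su.1)) hΦ).hasFDerivAt).comp su
    (hasFDerivAt_fst (𝕜 := ℝ) (p := su))
  have h₂ := ((HasDerivAt.scomp su.1 (h.hasDerivAt_chord (Φ su.1)) hΦ).hasFDerivAt).comp su
    (hasFDerivAt_fst (𝕜 := ℝ) (p := su))
  have h₃ : HasFDerivAt (fun su : ℝ × ℝ => G (Φ su.1) + su.2 • chord G (Φ su.1)) _ su :=
    h₁.add ((hasFDerivAt_snd (𝕜 := ℝ) (p := su)).smul h₂)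
  rw [surjective_smul_add_smul_iff (q := chord G (Φ su.1)) (p := (deriv Φ su.1 *
    (r (Φ su.1) - su.2 * (r (Φ su.1) + r (Φ su.1 + Real.pi)))) • dirVec (Φ su.1))
    (h.chord_ne_zero _)]
  · have hpos := h.radius_add_radius_pos (Φ su.1)
    rw [not_not, cross2_smul_left, mul_eq_zero_iff_right (h.cross2_dirVec_antipodal_chord_pos _).ne',
      mul_eq_zero_iff_left (h.deriv_angle_ne_zero _), sub_eq_zero, chordRatio,
      eq_div_iff hpos.ne', eq_comm]
  · intro z
    rw [h₃.fderiv]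
    simp
    module

theorem css_eq_range (h : IsAngleParam M.γ G r Φ Ψ) : CSS M = range (chordEnvelope G r) := by
  ext p
  constructor
  · rintro ⟨T, -, hT, su, rfl, hsu⟩
    rw [h.chordFamily_eq hT, h.not_surjective_fderiv_iff] at hsu
    refine ⟨Φ su.1, ?_⟩
    simp only [h.chordFamily_eq hT, hsu, chordEnvelope]
  · rintro ⟨x, rfl⟩
    refine ⟨fun s => Ψ (Φ s + Real.pi),
      h.symm_smooth.comp (h.angle_smooth.add contDiff_const), h.parallelParams,
      (Ψ x, chordRatio r x), ?_⟩
    rw [h.chordFamily_eq h.parallelParams, h.not_surjective_fderiv_iff]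
    simp only [h.angle_symm, chordEnvelope, and_self]

end PlaneCurve

end IsAngleParam

/-- For a generic convex curve `M`, the Centre Symmetry Set and the
Wigner caustic each have at least three cusps. -/
theorem at_least_three_cusps
    (M : PlaneCurve) (hM : M.IsConvexCurve)
    (hgenC : ∀ p : E2, IsSingularPoint (CSS M) p → IsCuspPoint (CSS M) p)
    (hgenW : ∀ p : E2,
      IsSingularPoint (Eqd M (1/2)) p → IsCuspPoint (Eqd M (1/2)) p)
    (hfinC : {p : E2 | IsCuspPoint (CSS M) p}.Finite)
    (hfinW : {p : E2 | IsCuspPoint (Eqd M (1/2)) p}.Finite) :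
    3 ≤ {p : E2 | IsCuspPoint (CSS M) p}.ncard ∧
    3 ≤ {p : E2 | IsCuspPoint (Eqd M (1/2)) p}.ncard := by
  obtain ⟨G, r, Φ, Ψ, h⟩ := hM.exists_isAngleParam
  rw [h.css_eq_range] at hgenC hfinC ⊢
  rw [h.eqd_eq_range] at hgenW hfinW ⊢
  exact ⟨h.isHalfTurnCurve_chordEnvelope.three_le_ncard_cusps hgenC hfinC,
    h.isHalfTurnCurve_midpointCurve.three_le_ncard_cusps hgenW hfinW⟩
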